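/- arXiv:2410.14591 — 2 statements merged into one kernel-verified Lean document; each statement's English description precedes it below -/
import Mathlib

section
/- Suppose p > 1. Then the set B^p = {μ ∈ M(Z) : ∫_Z (1 + d(z,e)^p) d|μ|(z) ≤ 1} is compact in KRu(Z): every sequence in B^p has a subsequence converging in the Kantorovich–Rubinstein norm ‖·‖_KRu to an element of B^p. -/
open MeasureTheory Filter Topology
open scoped ENNReal NNReal

noncomputable section
attribute [local instance] Classical.propDecidable

variable {Z : Type*} [MetricSpace Z] [MeasurableSpace Z] [BorelSpace Z]

/-- Integral `∫ f dμ` of a function against a finite signed measure, via Jordan decomposition. -/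
def sInteg (μ : SignedMeasure Z) (f : Z → ℝ) : ℝ :=
  (∫ z, f z ∂μ.toJordanDecomposition.posPart) - ∫ z, f z ∂μ.toJordanDecomposition.negPart

/-- Total variation norm `‖μ‖_TV`. -/
def tvNorm (μ : SignedMeasure Z) : ℝ := (μ.totalVariation Set.univ).toReal

/-- The unbalanced Kantorovich–Rubinstein norm
`‖μ‖_KRu = |μ(Z)| + sup { ∫ f dμ : f(e) = 0, Lip(f) ≤ 1 }`. -/
def kruNorm (e : Z) (μ : SignedMeasure Z) : ℝ :=
  |μ Set.univ| +
    sSup {r : ℝ | ∃ f : Z → ℝ, f e = 0 ∧ LipschitzWith 1 f ∧ r = sInteg μ f}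

/-- The balanced Kantorovich–Rubinstein norm `‖μ‖_KR = sup { ∫ f dμ : f(e) = 0, Lip(f) ≤ 1 }`. -/
def krNorm (e : Z) (μ : SignedMeasure Z) : ℝ :=
  sSup {r : ℝ | ∃ f : Z → ℝ, f e = 0 ∧ LipschitzWith 1 f ∧ r = sInteg μ f}

/-- `μ ∈ M_1(Z)`: finite first moment, `∫ d(z,e) d|μ| < ∞`. -/
def MemM1 (e : Z) (μ : SignedMeasure Z) : Prop :=
  (∫⁻ z, ENNReal.ofReal (dist z e) ∂μ.totalVariation) < ⊤

/-- `μ ∈ M_p(Z)`: finite `p`-th moment, `∫ d(z,e)^p d|μ| < ∞`. -/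
def MemMp (e : Z) (p : ℝ) (μ : SignedMeasure Z) : Prop :=
  (∫⁻ z, ENNReal.ofReal (dist z e ^ p) ∂μ.totalVariation) < ⊤

/-- `∫ (1 + d(z,e)^p) d|μ|` as an extended nonnegative real number. -/
def momLint (e : Z) (p : ℝ) (μ : SignedMeasure Z) : ℝ≥0∞ :=
  ∫⁻ z, ENNReal.ofReal (1 + dist z e ^ p) ∂μ.totalVariation

/-- Dirac measure at a point, as a signed measure. -/
def diracSM (x : Z) : SignedMeasure Z := (Measure.dirac x).toSignedMeasure

/-- The regularizer `G_{α,β}(μ) = α‖μ‖_KRu + β ∫ (1 + d(z,e)^p) d|μ|` if `μ ∈ M_p(Z)`,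
and `+∞` otherwise, as an extended real number. -/
def Gab (e : Z) (p α β : ℝ) (μ : SignedMeasure Z) : EReal :=
  if MemMp e p μ then ((α * kruNorm e μ + β * (momLint e p μ).toReal : ℝ) : EReal) else ⊤

/-- A geodesic metric space: any two points are joined by points realizing all
intermediate distance proportions. -/
def IsGeodesic (Z : Type*) [MetricSpace Z] : Prop :=
  ∀ x y : Z, ∀ t : ℝ, 0 ≤ t → t ≤ 1 →
    ∃ z : Z, dist x z = t * dist x y ∧ dist z y = (1 - t) * dist x y

set_option linter.unusedSectionVars false

theorem geo_point (hgeo : IsGeodesic Z) (e x : Z) (r δ : ℝ) (hr : 0 ≤ r) (hδ : 0 ≤ δ)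
    (hx : dist e x ≤ r + δ) : ∃ z : Z, dist e z ≤ r ∧ dist z x ≤ δ := by
  rcases le_or_gt (dist e x) r with h | h
  · exact ⟨x, h, by simpa using hδ⟩
  · have hd : 0 < dist e x := lt_of_le_of_lt hr h
    obtain ⟨z, h1, h2⟩ := hgeo e x (r / dist e x) (by positivity) ((div_le_one hd).2 h.le)
    refine ⟨z, ?_, ?_⟩
    · rw [h1, div_mul_cancel₀ _ hd.ne']
    · rw [h2, sub_mul, div_mul_cancel₀ _ hd.ne']
      linarith

theorem hopf_rinow [LocallyCompactSpace Z] [CompleteSpace Z] (hgeo : IsGeodesic Z) (e : Z)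
    (r₀ : ℝ) : IsCompact (Metric.closedBall e r₀) := by
  by_contra hcon
  let S : Set ℝ := {r | 0 ≤ r ∧ IsCompact (Metric.closedBall e r)}
  have h0 : (0 : ℝ) ∈ S := ⟨le_rfl, by simp⟩
  have hbdd : BddAbove S := by
    refine ⟨r₀, fun r hr => ?_⟩
    by_contra hlt
    push Not at hlt
    exact hcon (hr.2.of_isClosed_subset Metric.isClosed_closedBall
      (Metric.closedBall_subset_closedBall hlt.le))
  set s := sSup S with hs
  have hs0 : 0 ≤ s := le_csSup hbdd h0
  have hsc : IsCompact (Metric.closedBall e s) := by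
    rw [isCompact_iff_totallyBounded_isComplete]
    refine ⟨?_, Metric.isClosed_closedBall.isComplete⟩
    rw [Metric.totallyBounded_iff]
    intro ε hε
    obtain ⟨r, hrS, hr⟩ := exists_lt_of_lt_csSup ⟨0, h0⟩ (show s - ε / 2 < sSup S by linarith)
    obtain ⟨t, htf, ht⟩ := Metric.totallyBounded_iff.1 hrS.2.totallyBounded (ε / 2) (by positivity)
    refine ⟨t, htf, fun x hx => ?_⟩
    have hrs : r ≤ s := le_csSup hbdd hrS
    obtain ⟨z, hz1, hz2⟩ := geo_point hgeo e x r (s - r) hrS.1 (by linarith)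
      (by rw [dist_comm]; simpa using hx)
    have := ht (show z ∈ Metric.closedBall e r by rw [Metric.mem_closedBall, dist_comm]; exact hz1)
    simp only [Set.mem_iUnion, Metric.mem_ball, exists_prop] at this ⊢
    obtain ⟨y, hy, hzy⟩ := this
    refine ⟨y, hy, ?_⟩
    have := dist_triangle x z y
    rw [dist_comm x z] at this
    linarith
  obtain ⟨δ, hδ, hc⟩ := hsc.exists_isCompact_cthickening
  have : s + δ ∈ S := by
    refine ⟨by linarith, hc.of_isClosed_subset Metric.isClosed_closedBall fun x hx => ?_⟩
    obtain ⟨z, hz1, hz2⟩ := geo_point hgeo e x s δ hs0 hδ.le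
      (by rw [dist_comm]; simpa using hx)
    refine Metric.mem_cthickening_of_dist_le x z δ _ ?_ (by rwa [dist_comm])
    rw [Metric.mem_closedBall, dist_comm]; exact hz1
  have := le_csSup hbdd this
  linarith

/-- the weight `1 + d(z,e)^p` -/
def wt (e : Z) (p : ℝ) (z : Z) : ℝ := 1 + dist z e ^ p

theorem wt_cont (e : Z) (p : ℝ) (hp : 1 < p) : Continuous (wt e p) := by
  unfold wt
  exact continuous_const.add
    ((continuous_id.dist continuous_const).rpow_const fun _ => Or.inr (by linarith))

theorem one_le_wt (e : Z) (p : ℝ) (z : Z) : 1 ≤ wt e p z := by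
  unfold wt
  have := Real.rpow_nonneg (dist_nonneg (x := z) (y := e)) p
  linarith

theorem dist_le_wt (e : Z) (p : ℝ) (hp : 1 < p) (z : Z) : dist z e ≤ wt e p z := by
  have h1 := one_le_wt e p z
  rcases le_or_gt (dist z e) 1 with h | h
  · linarith
  · have := Real.rpow_le_rpow_of_exponent_le h.le hp.le
    rw [Real.rpow_one] at this
    unfold wt; linarith

theorem dist_le_tail (e : Z) (p : ℝ) (hp : 1 < p) (R : ℝ) (hR : 0 < R) (z : Z)
    (hz : R ≤ dist z e) : dist z e ≤ R ^ (1 - p) * wt e p z := by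
  have hd : 0 < dist z e := lt_of_lt_of_le hR hz
  have h1 : dist z e = dist z e ^ (1 - p) * dist z e ^ p := by
    rw [← Real.rpow_add hd]; simp
  have h2 : dist z e ^ (1 - p) ≤ R ^ (1 - p) :=
    Real.rpow_le_rpow_of_nonpos hR hz (by linarith)
  have h3 : 0 ≤ dist z e ^ p := Real.rpow_nonneg dist_nonneg p
  have h4 : 0 ≤ R ^ (1 - p) := Real.rpow_nonneg hR.le _
  unfold wt
  nlinarith [mul_le_mul_of_nonneg_right h2 h3]

theorem exists_R (p : ℝ) (hp : 1 < p) (ε : ℝ) (hε : 0 < ε) :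
    ∃ R : ℝ, 0 < R ∧ R ^ (1 - p) ≤ ε := by
  have h := tendsto_rpow_neg_atTop (show 0 < p - 1 by linarith)
  obtain ⟨R, h1, h2⟩ := ((h.eventually (gt_mem_nhds hε)).and (eventually_gt_atTop 0)).exists
  refine ⟨R, h2, ?_⟩
  rw [show 1 - p = -(p - 1) by ring]
  exact h1.le

/-- the class of test functions -/
def TestLip (e : Z) (f : Z → ℝ) : Prop := f e = 0 ∧ LipschitzWith 1 f

theorem TestLip.abs_le {e : Z} {f : Z → ℝ} (hf : TestLip e f) (z : Z) : |f z| ≤ dist z e := by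
  have := hf.2.dist_le_mul z e
  rw [hf.1, Real.dist_eq] at this
  simpa using this

/-- finite net among the test functions, for the weighted sup norm -/
theorem exists_net (e : Z) (p : ℝ) (hp : 1 < p)
    (hK : ∀ r, IsCompact (Metric.closedBall e r)) (ε : ℝ) (hε : 0 < ε) :
    ∃ T : Set (Z → ℝ), T.Finite ∧ (∀ g ∈ T, TestLip e g) ∧
      ∀ f, TestLip e f → ∃ g ∈ T, ∀ z, |f z - g z| ≤ ε * wt e p z := by
  obtain ⟨R, hR, hRε⟩ := exists_R p hp (ε / 2) (by positivity)
  obtain ⟨t, htK, htf, ht⟩ := Metric.finite_approx_of_totallyBounded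
    (hK R).totallyBounded (ε / 3) (by positivity)
  have : Fintype t := htf.fintype
  let Φ : (Z → ℝ) → (t → ℝ) := fun f x => f x
  let F : Set (Z → ℝ) := {f | TestLip e f}
  have hbd : TotallyBounded (Φ '' F) := by
    refine (isCompact_closedBall (0 : t → ℝ) R).totallyBounded.subset ?_
    rintro _ ⟨f, hf, rfl⟩
    rw [mem_closedBall_zero_iff, pi_norm_le_iff_of_nonneg hR.le]
    intro x
    have h1 := htK x.2
    rw [Metric.mem_closedBall] at h1
    exact (hf.abs_le _).trans h1
  obtain ⟨u, huF, huf, hu⟩ := Metric.finite_approx_of_totallyBounded hbd (ε / 3) (by positivity)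
  obtain ⟨T, hTF, hTf, hTu⟩ :=
    huf.exists_subset_finite_image_eq huF
  refine ⟨T, hTf, hTF, fun f hf => ?_⟩
  have := hu ⟨f, hf, rfl⟩
  simp only [Set.mem_iUnion, exists_prop] at this
  obtain ⟨y, hy, hfy⟩ := this
  rw [← hTu] at hy
  obtain ⟨g, hg, rfl⟩ := hy
  refine ⟨g, hg, fun z => ?_⟩
  have hgT := hTF hg
  have hw := one_le_wt e p z
  rcases le_or_gt (dist z e) R with hz | hz
  · have := ht (show z ∈ Metric.closedBall e R from hz)
    simp only [Set.mem_iUnion, exists_prop, Metric.mem_ball] at this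
    obtain ⟨y, hy, hzy⟩ := this
    have h1 : |f y - g y| < ε / 3 := by
      have := (dist_pi_lt_iff (by positivity)).1 hfy ⟨y, hy⟩
      exact this
    have h2 := hf.2.dist_le_mul z y
    have h3 := (hgT : TestLip e g).2.dist_le_mul z y
    rw [Real.dist_eq] at h2 h3
    simp only [NNReal.coe_one, one_mul] at h2 h3
    have : |f z - g z| ≤ ε := by
      rw [abs_le] at *
      rw [abs_lt] at h1
      constructor <;> linarith
    nlinarith
  · have h1 := hf.abs_le z
    have h2 := (hgT : TestLip e g).abs_le z
    have h3 := dist_le_tail e p hp R hR z hz.le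
    have h4 : R ^ (1 - p) * wt e p z ≤ ε / 2 * wt e p z :=
      mul_le_mul_of_nonneg_right hRε (by linarith)
    have := abs_sub (f z) (g z)
    linarith

/-- truncation -/
theorem exists_bcf (e : Z) (p : ℝ) (hp : 1 < p) (ε : ℝ) (hε : 0 < ε) (f : Z → ℝ)
    (hf : TestLip e f) :
    ∃ h : BoundedContinuousFunction Z ℝ, ∀ z, |f z - h z| ≤ ε * wt e p z := by
  obtain ⟨R, hR, hRε⟩ := exists_R p hp ε hε
  have hb : ∀ z, ‖max (-R) (min R (f z))‖ ≤ R := fun z => by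
    rw [Real.norm_eq_abs, abs_le]
    exact ⟨le_max_left _ _, max_le (by linarith) (min_le_left _ _)⟩
  refine ⟨BoundedContinuousFunction.ofNormedAddCommGroup (fun z => max (-R) (min R (f z)))
    (continuous_const.max (continuous_const.min hf.2.continuous)) R hb, fun z => ?_⟩
  have hw := one_le_wt e p z
  have hfz := hf.abs_le z
  simp only [BoundedContinuousFunction.coe_ofNormedAddCommGroup]
  rcases le_or_gt |f z| R with h | h
  · have h' := abs_le.1 h
    rw [min_eq_right h'.2, max_eq_right h'.1]
    simp only [sub_self, abs_zero]
    positivity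
  · have h3 := dist_le_tail e p hp R hR z (h.le.trans hfz)
    have h4 : R ^ (1 - p) * wt e p z ≤ ε * wt e p z :=
      mul_le_mul_of_nonneg_right hRε (by linarith)
    have h5 : |f z - max (-R) (min R (f z))| ≤ |f z| := by
      rcases le_total 0 (f z) with h0 | h0
      · rw [abs_of_nonneg h0] at h ⊢
        rw [min_eq_left h.le, max_eq_right (by linarith), abs_of_nonneg] <;> linarith
      · rw [abs_of_nonpos h0] at h ⊢
        rw [min_eq_right (by linarith), max_eq_left (by linarith), abs_of_nonpos] <;> linarith
    linarith

/-- `ν` has weighted mass at most one -/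
def WB (e : Z) (p : ℝ) (ν : Measure Z) : Prop :=
  ∫⁻ z, ENNReal.ofReal (wt e p z) ∂ν ≤ 1

theorem WB.integrable {e : Z} {p : ℝ} (hp : 1 < p) {ν : Measure Z} (h : WB e p ν) :
    Integrable (wt e p) ν := by
  refine ⟨(wt_cont e p hp).measurable.aestronglyMeasurable, ?_⟩
  rw [hasFiniteIntegral_iff_ofReal
    (Eventually.of_forall fun z => zero_le_one.trans (one_le_wt e p z))]
  exact lt_of_le_of_lt h ENNReal.one_lt_top

theorem WB.integral_le {e : Z} {p : ℝ} (hp : 1 < p) {ν : Measure Z} (h : WB e p ν) :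
    ∫ z, wt e p z ∂ν ≤ 1 := by
  rw [integral_eq_lintegral_of_nonneg_ae
    (Eventually.of_forall fun z => zero_le_one.trans (one_le_wt e p z))
    (wt_cont e p hp).measurable.aestronglyMeasurable]
  exact ENNReal.toReal_le_of_le_ofReal zero_le_one (by simpa using (show ∫⁻ z, ENNReal.ofReal (wt e p z) ∂ν ≤ 1 from h))

theorem WB.mono {e : Z} {p : ℝ} {ν ν' : Measure Z} (h : WB e p ν) (hle : ν' ≤ ν) :
    WB e p ν' :=
  (lintegral_mono' hle le_rfl).trans h

theorem WB.univ_le {e : Z} {p : ℝ} {ν : Measure Z} (h : WB e p ν) : ν Set.univ ≤ 1 := by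
  refine le_trans ?_ h
  rw [← lintegral_one]
  refine lintegral_mono fun z => ?_
  simpa using one_le_wt e p z

theorem WB.compl_le {e : Z} {p : ℝ} (hp : 1 < p) {ν : Measure Z} (h : WB e p ν) (n : ℕ) :
    ν (Metric.closedBall e ((n : ℝ) + 1))ᶜ ≤ ((1 / ((n : ℝ≥0) + 1) : ℝ≥0) : ℝ≥0∞) := by
  have h1 := mul_meas_ge_le_lintegral
    (μ := ν) ((wt_cont e p hp).measurable.ennreal_ofReal) ((n : ℝ≥0∞) + 1)
  have h2 : (Metric.closedBall e ((n : ℝ) + 1))ᶜ ⊆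
      {z | (n : ℝ≥0∞) + 1 ≤ ENNReal.ofReal (wt e p z)} := by
    intro z hz
    simp only [Set.mem_compl_iff, Metric.mem_closedBall, not_le] at hz
    have h3 := dist_le_wt e p hp z
    have : ENNReal.ofReal ((n : ℝ) + 1) ≤ ENNReal.ofReal (wt e p z) :=
      ENNReal.ofReal_le_ofReal (by linarith)
    rw [ENNReal.ofReal_add (by positivity) zero_le_one] at this
    simpa using this
  have h3 := (mul_le_mul_right (measure_mono h2) ((n : ℝ≥0∞) + 1)).trans (h1.trans h)
  rw [ENNReal.coe_div (by positivity), ENNReal.le_div_iff_mul_le (by simp) (by simp)]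
  rw [mul_comm] at h3
  simpa using h3

theorem TestLip.integrable {e : Z} {p : ℝ} (hp : 1 < p) {ν : Measure Z} (h : WB e p ν)
    {f : Z → ℝ} (hf : TestLip e f) : Integrable f ν := by
  refine (h.integrable hp).mono' hf.2.continuous.measurable.aestronglyMeasurable
    (Eventually.of_forall fun z => ?_)
  exact (hf.abs_le z).trans (dist_le_wt e p hp z)

theorem abs_integral_sub_le {e : Z} {p : ℝ} (hp : 1 < p) {ν : Measure Z} (h : WB e p ν)
    {f g : Z → ℝ} (hf : Integrable f ν) (hg : Integrable g ν) {ε : ℝ} (hε : 0 ≤ ε)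
    (hfg : ∀ z, |f z - g z| ≤ ε * wt e p z) :
    |∫ z, f z ∂ν - ∫ z, g z ∂ν| ≤ ε := by
  rw [← integral_sub hf hg]
  calc |∫ z, (f z - g z) ∂ν| ≤ ∫ z, ε * wt e p z ∂ν :=
        norm_integral_le_of_norm_le (f := fun z => f z - g z) ((h.integrable hp).const_mul ε)
          (Eventually.of_forall hfg)
    _ = ε * ∫ z, wt e p z ∂ν := integral_const_mul _ _
    _ ≤ ε * 1 := mul_le_mul_of_nonneg_left (h.integral_le hp) hε
    _ = ε := mul_one ε

theorem uniform_conv {e : Z} {p : ℝ} (hp : 1 < p)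
    (hK : ∀ r, IsCompact (Metric.closedBall e r)) {ι : Type*} {L : Filter ι}
    {P : ι → FiniteMeasure Z} {P' : FiniteMeasure Z} (hP : Tendsto P L (𝓝 P'))
    (hW : ∀ i, WB e p (P i : Measure Z)) (hW' : WB e p (P' : Measure Z)) (ε : ℝ) (hε : 0 < ε) :
    ∀ᶠ i in L, ∀ f, TestLip e f →
      |∫ z, f z ∂(P i : Measure Z) - ∫ z, f z ∂(P' : Measure Z)| ≤ ε := by
  obtain ⟨T, hTf, hTL, hT⟩ := exists_net e p hp hK (ε / 5) (by positivity)
  have key : ∀ g ∈ T, ∀ᶠ i in L,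
      |∫ z, g z ∂(P i : Measure Z) - ∫ z, g z ∂(P' : Measure Z)| ≤ 3 * (ε / 5) := by
    intro g hg
    obtain ⟨h, hh⟩ := exists_bcf e p hp (ε / 5) (by positivity) g (hTL g hg)
    have := FiniteMeasure.tendsto_iff_forall_integral_tendsto.1 hP h
    rw [Metric.tendsto_nhds] at this
    filter_upwards [this (ε / 5) (by positivity)] with i hi
    rw [Real.dist_eq] at hi
    have h1 := abs_integral_sub_le hp (hW i) ((hTL g hg).integrable hp (hW i)) (h.integrable _)
      (by positivity) hh
    have h2 := abs_integral_sub_le hp hW' ((hTL g hg).integrable hp hW') (h.integrable _)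
      (by positivity) hh
    rw [abs_le] at *
    rw [abs_lt] at hi
    constructor <;> linarith
  filter_upwards [(Filter.eventually_all_finite hTf).2 key] with i hi f hf
  obtain ⟨g, hg, hfg⟩ := hT f hf
  have h0 := hi g hg
  have h1 := abs_integral_sub_le hp (hW i) (hf.integrable hp (hW i))
    ((hTL g hg).integrable hp (hW i)) (by positivity) hfg
  have h2 := abs_integral_sub_le hp hW' (hf.integrable hp hW')
    ((hTL g hg).integrable hp hW') (by positivity) hfg
  rw [abs_le] at *
  constructor <;> linarith

theorem WB_of_tendsto {e : Z} {p : ℝ} (hp : 1 < p) {ι : Type*} {L : Filter ι} [L.NeBot]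
    {P : ι → FiniteMeasure Z} {P' : FiniteMeasure Z} (hP : Tendsto P L (𝓝 P'))
    (hW : ∀ i, WB e p (P i : Measure Z)) : WB e p (P' : Measure Z) := by
  have hc : Continuous fun z => (wt e p z).toNNReal :=
    continuous_real_toNNReal.comp (wt_cont e p hp)
  let w : ℕ → BoundedContinuousFunction Z ℝ≥0 := fun M =>
    BoundedContinuousFunction.mkOfBound
      ⟨fun z => min (wt e p z).toNNReal (M : ℝ≥0), hc.min continuous_const⟩ M (by
        intro x y
        simp only [ContinuousMap.coe_mk, NNReal.dist_eq]
        have h1 : ((min (wt e p x).toNNReal (M : ℝ≥0) : ℝ≥0) : ℝ) ≤ M := by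
          exact_mod_cast min_le_right _ _
        have h2 : ((min (wt e p y).toNNReal (M : ℝ≥0) : ℝ≥0) : ℝ) ≤ M := by
          exact_mod_cast min_le_right _ _
        have h3 := (min (wt e p x).toNNReal (M : ℝ≥0)).2
        have h4 := (min (wt e p y).toNNReal (M : ℝ≥0)).2
        rw [abs_le]
        constructor <;> linarith [NNReal.coe_nonneg (min (wt e p x).toNNReal (M : ℝ≥0)),
          NNReal.coe_nonneg (min (wt e p y).toNNReal (M : ℝ≥0))])
  have hw : ∀ M z, w M z = min (wt e p z).toNNReal (M : ℝ≥0) := fun M z => rfl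
  have h1 : ∀ M, ∫⁻ z, (w M z : ℝ≥0∞) ∂(P' : Measure Z) ≤ 1 := by
    intro M
    refine le_of_tendsto' (FiniteMeasure.tendsto_iff_forall_lintegral_tendsto.1 hP (w M))
      fun i => le_trans (lintegral_mono fun z => ?_) (hW i)
    rw [hw]
    exact ENNReal.coe_le_coe.2 (min_le_left _ _)
  have h2 : ∀ z, ENNReal.ofReal (wt e p z) = ⨆ M, (w M z : ℝ≥0∞) := by
    intro z
    apply le_antisymm
    · obtain ⟨M, hM⟩ := exists_nat_ge (wt e p z).toNNReal
      refine le_iSup_of_le M ?_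
      rw [hw, min_eq_left hM]
      exact le_rfl
    · refine iSup_le fun M => ?_
      rw [hw]
      exact ENNReal.coe_le_coe.2 (min_le_left _ _)
  unfold WB
  simp_rw [h2]
  rw [lintegral_iSup]
  · exact iSup_le h1
  · intro M
    exact (w M).continuous.measurable.coe_nnreal_ennreal
  · intro M N hMN z
    simp only [hw]
    exact ENNReal.coe_le_coe.2 (min_le_min_left _ (by exact_mod_cast hMN))

theorem jordan_sub (A B : Measure Z) [IsFiniteMeasure A] [IsFiniteMeasure B] :
    (A.toSignedMeasure - B.toSignedMeasure).totalVariation ≤ A + B := by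
  rw [SignedMeasure.totalVariation, Measure.toJordanDecomposition_toSignedMeasure_sub]
  exact add_le_add Measure.sub_le Measure.sub_le

theorem sInteg_sub (A B : Measure Z) [IsFiniteMeasure A] [IsFiniteMeasure B] (f : Z → ℝ)
    (hA : Integrable f A) (hB : Integrable f B) :
    sInteg (A.toSignedMeasure - B.toSignedMeasure) f = ∫ z, f z ∂A - ∫ z, f z ∂B := by
  unfold sInteg
  rw [Measure.toJordanDecomposition_toSignedMeasure_sub,
    Measure.jordanDecompositionOfToSignedMeasureSub_posPart,
    Measure.jordanDecompositionOfToSignedMeasureSub_negPart]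
  have hAB : (A - B) + B = (B - A) + A := by
    have h := Measure.sub_toSignedMeasure_eq_toSignedMeasure_sub (μ := A) (ν := B)
    rw [← Measure.toSignedMeasure_eq_toSignedMeasure_iff, Measure.toSignedMeasure_add,
      Measure.toSignedMeasure_add]
    rw [sub_eq_sub_iff_add_eq_add] at h
    rw [← h, add_comm]
  have h1 : Integrable f (A - B) := hA.mono_measure Measure.sub_le
  have h2 : Integrable f (B - A) := hB.mono_measure Measure.sub_le
  have := congrArg (fun ν => ∫ z, f z ∂ν) hAB
  simp only [integral_add_measure h1 hB, integral_add_measure h2 hA] at this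
  linarith

/-- For `p > 1`, the set `B^p = {μ ∈ M(Z) : ∫ (1 + d(z,e)^p) d|μ| ≤ 1}` is
compact in `KRu(Z)`: every sequence in `B^p` has a subsequence converging in the
Kantorovich–Rubinstein norm to an element of `B^p`. -/
theorem pMoment_ball_compact_in_kru [LocallyCompactSpace Z] [CompleteSpace Z]
    [TopologicalSpace.SeparableSpace Z] (hgeo : IsGeodesic Z) (e : Z)
    (p : ℝ) (hp : 1 < p)
    (μ : ℕ → SignedMeasure Z) (hB : ∀ n, momLint e p (μ n) ≤ 1) :
    ∃ (φ : ℕ → ℕ) (μlim : SignedMeasure Z), StrictMono φ ∧ momLint e p μlim ≤ 1 ∧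
      Tendsto (fun k => kruNorm e (μ (φ k) - μlim)) atTop (nhds 0) := by
  have hK : ∀ r, IsCompact (Metric.closedBall e r) := hopf_rinow hgeo e
  let P : ℕ → FiniteMeasure Z := fun n => ⟨(μ n).toJordanDecomposition.posPart, inferInstance⟩
  let N : ℕ → FiniteMeasure Z := fun n => ⟨(μ n).toJordanDecomposition.negPart, inferInstance⟩
  have hPN : ∀ n, WB e p ((P n + N n : FiniteMeasure Z) : Measure Z) := fun n => hB n
  have hPW : ∀ n, WB e p (P n : Measure Z) := fun n =>
    (hPN n).mono (by rw [FiniteMeasure.toMeasure_add]; exact Measure.le_add_right le_rfl)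
  have hNW : ∀ n, WB e p (N n : Measure Z) := fun n =>
    (hPN n).mono (by rw [FiniteMeasure.toMeasure_add]; exact Measure.le_add_left le_rfl)
  have hμ : ∀ n, μ n = (P n : Measure Z).toSignedMeasure - (N n : Measure Z).toSignedMeasure :=
    fun n => (SignedMeasure.toSignedMeasure_toJordanDecomposition (μ n)).symm
  have hcomp := isCompact_setOfPred_finiteMeasure_mass_le_compl_isCompact_le (E := Z)
    (u := fun n : ℕ => 1 / ((n : ℝ≥0) + 1))
    (K := fun n : ℕ => Metric.closedBall e ((n : ℝ) + 1)) 1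
    tendsto_one_div_add_atTop_nhds_zero_nat (fun n => hK _) (Or.inl inferInstance)
  have hmem : ∀ Q : FiniteMeasure Z, WB e p (Q : Measure Z) →
      Q ∈ {μ : FiniteMeasure Z | μ.mass ≤ 1 ∧
        ∀ n : ℕ, μ (Metric.closedBall e ((n : ℝ) + 1))ᶜ ≤ 1 / ((n : ℝ≥0) + 1)} := by
    intro Q hQ
    refine ⟨?_, fun n => ?_⟩
    · rw [← ENNReal.coe_le_coe, FiniteMeasure.ennreal_mass]
      exact hQ.univ_le
    · rw [← ENNReal.coe_le_coe, FiniteMeasure.ennreal_coeFn_eq_coeFn_toMeasure]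
      exact hQ.compl_le hp n
  let U : Ultrafilter ℕ := Filter.hyperfilter ℕ
  have hlim : ∀ Q : ℕ → FiniteMeasure Z, (∀ n, WB e p (Q n : Measure Z)) →
      ∃ Q', Tendsto Q (U : Filter ℕ) (𝓝 Q') := by
    intro Q hQ
    obtain ⟨Q', -, h⟩ := hcomp.ultrafilter_le_nhds' (U.map Q)
      (Filter.Eventually.of_forall (f := (U : Filter ℕ)) fun n => hmem _ (hQ n))
    exact ⟨Q', h⟩
  obtain ⟨P', hP'⟩ := hlim P hPW
  obtain ⟨N', hN'⟩ := hlim N hNW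
  have hW' : WB e p ((P' + N' : FiniteMeasure Z) : Measure Z) :=
    WB_of_tendsto hp (hP'.add hN') hPN
  have hPW' : WB e p (P' : Measure Z) := WB_of_tendsto hp hP' hPW
  have hNW' : WB e p (N' : Measure Z) := WB_of_tendsto hp hN' hNW
  let μlim : SignedMeasure Z := (P' : Measure Z).toSignedMeasure - (N' : Measure Z).toSignedMeasure
  have hs : ∀ n, μ n - μlim = ((P n : Measure Z) + (N' : Measure Z)).toSignedMeasure -
      ((N n : Measure Z) + (P' : Measure Z)).toSignedMeasure := by
    intro n
    rw [hμ n, Measure.toSignedMeasure_add, Measure.toSignedMeasure_add]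
    simp only [μlim]
    abel
  have hconv : Tendsto (fun n => kruNorm e (μ n - μlim)) (U : Filter ℕ) (𝓝 0) := by
    have hm1 : Tendsto (fun n => (μ n - μlim) Set.univ) (U : Filter ℕ) (𝓝 0) := by
      have e1 : ∀ n, (μ n - μlim) Set.univ =
          (((P n).mass : ℝ) - P'.mass) - (((N n).mass : ℝ) - N'.mass) := by
        intro n
        rw [hμ n]
        simp only [μlim, VectorMeasure.sub_apply,
          Measure.toSignedMeasure_apply_measurable MeasurableSet.univ]
        simp only [Measure.real, ← FiniteMeasure.ennreal_mass, ENNReal.coe_toReal]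
        ring
      simp_rw [e1]
      have a1 := (NNReal.tendsto_coe.2 hP'.mass).sub_const (P'.mass : ℝ)
      have a2 := (NNReal.tendsto_coe.2 hN'.mass).sub_const (N'.mass : ℝ)
      simpa using a1.sub a2
    have hm2 : Tendsto (fun n => sSup {r : ℝ | ∃ f : Z → ℝ, f e = 0 ∧ LipschitzWith 1 f ∧
        r = sInteg (μ n - μlim) f}) (U : Filter ℕ) (𝓝 0) := by
      rw [Metric.tendsto_nhds]
      intro ε hε
      filter_upwards [uniform_conv hp hK hP' hPW hPW' (ε / 3) (by positivity),
        uniform_conv hp hK hN' hNW hNW' (ε / 3) (by positivity)] with n h1 h2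
      have hle : ∀ f, TestLip e f → sInteg (μ n - μlim) f ≤ 2 * (ε / 3) := by
        intro f hf
        have i1 := hf.integrable hp (hPW n)
        have i2 := hf.integrable hp (hNW n)
        have i3 := hf.integrable hp hPW'
        have i4 := hf.integrable hp hNW'
        rw [hs n, sInteg_sub _ _ f (i1.add_measure i4) (i2.add_measure i3),
          integral_add_measure i1 i4, integral_add_measure i2 i3]
        have := abs_le.1 (h1 f hf)
        have := abs_le.1 (h2 f hf)
        linarith
      have hz : (0 : ℝ) ∈ {r : ℝ | ∃ f : Z → ℝ, f e = 0 ∧ LipschitzWith 1 f ∧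
          r = sInteg (μ n - μlim) f} :=
        ⟨fun _ => 0, rfl, LipschitzWith.const' 0, by simp [sInteg]⟩
      have b1 : sSup {r : ℝ | ∃ f : Z → ℝ, f e = 0 ∧ LipschitzWith 1 f ∧
          r = sInteg (μ n - μlim) f} ≤ 2 * (ε / 3) := by
        refine csSup_le ⟨0, hz⟩ ?_
        rintro _ ⟨f, hf1, hf2, rfl⟩
        exact hle f ⟨hf1, hf2⟩
      have b2 : 0 ≤ sSup {r : ℝ | ∃ f : Z → ℝ, f e = 0 ∧ LipschitzWith 1 f ∧
          r = sInteg (μ n - μlim) f} := Real.sSup_nonneg' ⟨0, hz, le_rfl⟩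
      rw [Real.dist_eq, sub_zero, abs_of_nonneg b2]
      linarith
    have := hm1.abs.add hm2
    simpa [kruNorm] using this
  have hclus : MapClusterPt (0 : ℝ) atTop (fun n => kruNorm e (μ n - μlim)) := by
    refine (hconv.mapClusterPt).mono ?_
    rw [← Nat.cofinite_eq_atTop]
    exact Filter.hyperfilter_le_cofinite
  obtain ⟨φ, hφ, hφl⟩ := hclus.tendsto_subseq
  refine ⟨φ, μlim, hφ, ?_, hφl⟩
  exact hW'.mono (by rw [FiniteMeasure.toMeasure_add]; exact jordan_sub _ _)
end
end

section
/- Let α > 0, β > 0, p ≥ 1. Every extremal point (ν,c) of the set B_aux := {(ν,c) ∈ M_p^0(Z) × ℝ : G_aux(ν,c) ≤ 1}, where G_aux(ν,c) := α‖ν‖_KR + α|c| + β ∫_Z (1 + d(z,e)^p) d|ν + cδ_e|(z), is necessarily of the form (a δ_x − a δ_y, c) for some x, y ∈ Z, a > 0 and c ∈ ℝ. -/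
open MeasureTheory Filter Topology
open scoped ENNReal NNReal

noncomputable section
attribute [local instance] Classical.propDecidable

variable {Z : Type*} [MetricSpace Z] [MeasurableSpace Z] [BorelSpace Z]

/-- The auxiliary functional `𝒢_{α,β}(ν,c) = α‖ν‖_KR + α|c| + β ∫ (1 + d(z,e)^p) d|ν + cδ_e|`
on `M_p^0(Z) × ℝ`, with the moment integral taken in `[0,∞]`. -/
def Gaux (e : Z) (p α β : ℝ) (vc : SignedMeasure Z × ℝ) : ℝ≥0∞ :=
  ENNReal.ofReal (α * krNorm e vc.1) + ENNReal.ofReal (α * |vc.2|) +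
    ENNReal.ofReal β * momLint e p (vc.1 + vc.2 • diracSM e)

/-- Sandwich theorem: a convex set below a continuous sublinear functional. -/
lemma sandwich {H : Type*} [NormedAddCommGroup H] [NormedSpace ℝ H]
    (q : H → ℝ) (hqc : Continuous q) (hadd : ∀ x y, q (x + y) ≤ q x + q y)
    (hsm : ∀ (r : ℝ) x, 0 ≤ r → q (r • x) = r * q x)
    (C : Set (H × ℝ)) (hC : Convex ℝ C) (hne : C.Nonempty)
    (hle : ∀ b ∈ C, b.2 ≤ q b.1) :
    ∃ l : H →L[ℝ] ℝ, (∀ v, l v ≤ q v) ∧ ∀ b ∈ C, b.2 ≤ l b.1 := by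
  let D : Set (H × ℝ) := {b | q b.1 < b.2}
  have hDo : IsOpen D := isOpen_lt (hqc.comp continuous_fst) continuous_snd
  have hDc : Convex ℝ D := by
    intro x hx y hy a b ha hb hab
    simp only [D, Set.mem_ofPred_eq, Prod.fst_add, Prod.snd_add, Prod.smul_fst, Prod.smul_snd,
      smul_eq_mul] at *
    have h1 := hadd (a • x.1) (b • y.1)
    rw [hsm a _ ha, hsm b _ hb] at h1
    rcases eq_or_lt_of_le ha with h | h
    · have : b = 1 := by linarith
      subst this; subst h; simp at h1 ⊢; simpa using hy
    · nlinarith [mul_lt_mul_of_pos_left hx h, mul_le_mul_of_nonneg_left hy.le hb]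
  have hdisj : Disjoint D C := by
    rw [Set.disjoint_left]
    intro b hb hb'
    exact absurd (hle b hb') (not_le.2 hb)
  obtain ⟨F, u, hF1, hF2⟩ := geometric_hahn_banach_open hDc hDo hC hdisj
  have hdec : ∀ v t, F (v, t) = F (v, 0) + t * F (0, 1) := by
    intro v t
    have : ((v, t) : H × ℝ) = (v, 0) + t • (0, 1) := by simp
    rw [this, map_add, map_smul, smul_eq_mul]
  set s := F (0, 1) with hs
  obtain ⟨b0, hb0⟩ := hne
  have hq0 : q 0 = 0 := by simpa using hsm 0 0 le_rfl
  have hu0 : 0 ≤ u := by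
    by_contra hu
    push Not at hu
    -- (0,t) in D for t > 0
    have h1 : ∀ t : ℝ, 0 < t → t * s < u := by
      intro t ht
      have := hF1 (0, t) (by simpa [D, hq0] using ht)
      rw [hdec] at this
      have h0 : F ((0 : H), (0 : ℝ)) = 0 := map_zero F
      linarith
    have h2 := h1 1 one_pos
    have hsn : s < 0 := by linarith
    have h3 := h1 (u / (2 * s)) (div_pos_of_neg_of_neg hu (by linarith))
    have : u / (2 * s) * s = u / 2 := by
      have := hsn.ne
      field_simp
    linarith
  have hsneg : s < 0 := by
    by_contra hsn
    push Not at hsn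
    have h1 := hF2 b0 hb0
    have h2 := hF1 (b0.1, max b0.2 (q b0.1 + 1)) (by
      simp only [D, Set.mem_ofPred_eq]
      exact lt_of_lt_of_le (by linarith) (le_max_right _ _))
    rw [hdec] at h2
    have h3 := hdec b0.1 b0.2
    simp only [Prod.mk.eta] at h3
    rw [h3] at h1
    nlinarith [le_max_left b0.2 (q b0.1 + 1)]
  have hD0 : ∀ v t, q v < t → F (v, t) ≤ 0 := by
    intro v t h
    by_contra hpos
    push Not at hpos
    set r := (u + 1) / F (v, t) with hr
    have hr0 : 0 < r := by positivity
    have := hF1 (r • (v, t)) (by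
      simp only [D, Set.mem_ofPred_eq, Prod.smul_fst, Prod.smul_snd, smul_eq_mul, hsm r _ hr0.le]
      exact mul_lt_mul_of_pos_left h hr0)
    rw [map_smul, smul_eq_mul, hr, div_mul_cancel₀ _ hpos.ne'] at this
    linarith
  refine ⟨(-s)⁻¹ • F.comp (ContinuousLinearMap.inl ℝ H ℝ), ?_, ?_⟩
  · intro v
    have : F (v, 0) ≤ (-s) * q v := by
      refine le_of_forall_pos_le_add fun ε hε => ?_
      have := hD0 v (q v + ε / (-s)) (by
        have : 0 < ε / (-s) := div_pos hε (by linarith)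
        linarith)
      rw [hdec] at this
      have h2 : ε / (-s) * s = - ε := by
        have := hsneg.ne
        field_simp
      nlinarith
    simp only [smul_apply, ContinuousLinearMap.comp_apply,
      ContinuousLinearMap.inl_apply, smul_eq_mul]
    rw [inv_mul_le_iff₀ (by linarith)]
    exact this
  · intro b hb
    have h1 := hF2 b hb
    have h3 := hdec b.1 b.2
    simp only [Prod.mk.eta] at h3
    simp only [smul_apply, ContinuousLinearMap.comp_apply,
      ContinuousLinearMap.inl_apply, smul_eq_mul]
    rw [le_inv_mul_iff₀ (by linarith)]
    linarith

lemma lip_bdd_integrable {P : Measure Z} [IsFiniteMeasure P] {f : Z → ℝ} (hf : Continuous f)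
    {M : ℝ} (hM : ∀ z, |f z| ≤ M) [SecondCountableTopology Z] : Integrable f P :=
  Integrable.of_bound hf.aestronglyMeasurable M (ae_of_all _ (by simpa using hM))

lemma split_L2 [SecondCountableTopology Z] (P1 P2 N : Measure Z) [IsFiniteMeasure P1]
    [IsFiniteMeasure P2] [IsFiniteMeasure N] (K : ℝ)
    (hK : ∀ k : Z → ℝ, LipschitzWith 1 k → (∃ M, ∀ z, |k z| ≤ M) →
      ∫ z, k z ∂P1 + ∫ z, k z ∂P2 - ∫ z, k z ∂N ≤ K) :
    ∃ h : Lp ℝ 2 N, (0 ≤ᵐ[N] h) ∧ (h ≤ᵐ[N] fun _ => (1 : ℝ)) ∧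
      ∀ f g : Z → ℝ, LipschitzWith 1 f → LipschitzWith 1 g → (∃ M, ∀ z, |f z| ≤ M) →
        (∃ M, ∀ z, |g z| ≤ M) →
        ∫ z, f z ∂P1 + ∫ z, g z ∂P2 - ∫ z, g z ∂N - K ≤ ∫ z, h z * (f z - g z) ∂N := by
  have hvint : ∀ v : Lp ℝ 2 N, Integrable v N := fun v =>
    (Lp.memLp v).integrable (by norm_num)
  have hpint : ∀ v : Lp ℝ 2 N, Integrable (fun z => max (v z) 0) N := fun v => (hvint v).pos_part
  let q : Lp ℝ 2 N → ℝ := fun v => ∫ z, max (v z) 0 ∂N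
  have hqc : Continuous q := by
    have : q = fun v => inner ℝ (indicatorConstLp 2 MeasurableSet.univ
        (measure_ne_top N Set.univ) (1 : ℝ)) (Lp.posPart v) := by
      funext v
      rw [L2.inner_indicatorConstLp_one, setIntegral_univ]
      exact integral_congr_ae (Lp.coeFn_posPart v).symm
    rw [this]
    exact continuous_const.inner Lp.continuous_posPart
  let C : Set (Lp ℝ 2 N × ℝ) := {b | ∃ f g : Z → ℝ, LipschitzWith 1 f ∧ LipschitzWith 1 g ∧
    (∃ M, ∀ z, |f z| ≤ M) ∧ (∃ M, ∀ z, |g z| ≤ M) ∧ (b.1 =ᵐ[N] fun z => f z - g z) ∧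
    b.2 ≤ ∫ z, f z ∂P1 + ∫ z, g z ∂P2 - ∫ z, g z ∂N - K}
  have hcomb : ∀ (f f' : Z → ℝ) (a b : ℝ), 0 ≤ a → 0 ≤ b → a + b = 1 → LipschitzWith 1 f →
      LipschitzWith 1 f' → LipschitzWith 1 (fun z => a * f z + b * f' z) := by
    intro f f' a b ha hb hab hf hf'
    refine LipschitzWith.of_dist_le_mul fun x y => ?_
    have h1 := hf.dist_le_mul x y
    have h2 := hf'.dist_le_mul x y
    simp only [NNReal.coe_one, one_mul, Real.dist_eq] at *
    calc |a * f x + b * f' x - (a * f y + b * f' y)|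
        = |a * (f x - f y) + b * (f' x - f' y)| := by ring_nf
      _ ≤ |a * (f x - f y)| + |b * (f' x - f' y)| := abs_add_le _ _
      _ = a * |f x - f y| + b * |f' x - f' y| := by
          rw [abs_mul, abs_mul, abs_of_nonneg ha, abs_of_nonneg hb]
      _ ≤ a * dist x y + b * dist x y := by gcongr
      _ = dist x y := by rw [← add_mul, hab, one_mul]
  have hcombB : ∀ (f f' : Z → ℝ) (a b : ℝ), (∃ M, ∀ z, |f z| ≤ M) → (∃ M, ∀ z, |f' z| ≤ M) →
      (∃ M, ∀ z, |a * f z + b * f' z| ≤ M) := by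
    rintro f f' a b ⟨M, hM⟩ ⟨M', hM'⟩
    refine ⟨|a| * M + |b| * M', fun z => (abs_add_le _ _).trans ?_⟩
    rw [abs_mul, abs_mul]
    gcongr
    · exact hM z
    · exact hM' z
  have hI : ∀ (Q : Measure Z) [IsFiniteMeasure Q] (f : Z → ℝ), LipschitzWith 1 f →
      (∃ M, ∀ z, |f z| ≤ M) → Integrable f Q := by
    rintro Q _ f hf ⟨M, hM⟩
    exact lip_bdd_integrable hf.continuous hM
  have hcombI : ∀ (Q : Measure Z) [IsFiniteMeasure Q] (f f' : Z → ℝ) (a b : ℝ),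
      LipschitzWith 1 f → LipschitzWith 1 f' →
      (∃ M, ∀ z, |f z| ≤ M) → (∃ M, ∀ z, |f' z| ≤ M) →
      ∫ z, a * f z + b * f' z ∂Q = a * ∫ z, f z ∂Q + b * ∫ z, f' z ∂Q := by
    intro Q _ f f' a b hf hf' hM hM'
    rw [integral_add ((hI Q f hf hM).const_mul a) ((hI Q f' hf' hM').const_mul b),
      integral_const_mul, integral_const_mul]
  have hC : Convex ℝ C := by
    rintro x ⟨f, g, hf, hg, hfM, hgM, hx1, hx2⟩ y ⟨f', g', hf', hg', hfM', hgM', hy1, hy2⟩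
      a b ha hb hab
    refine ⟨fun z => a * f z + b * f' z, fun z => a * g z + b * g' z,
      hcomb f f' a b ha hb hab hf hf', hcomb g g' a b ha hb hab hg hg',
      hcombB _ _ _ _ hfM hfM', hcombB _ _ _ _ hgM hgM', ?_, ?_⟩
    · simp only [Prod.fst_add, Prod.smul_fst]
      filter_upwards [hx1, hy1, Lp.coeFn_add (a • x.1) (b • y.1), Lp.coeFn_smul a x.1,
        Lp.coeFn_smul b y.1] with z h1 h2 h3 h4 h5
      rw [h3, Pi.add_apply, h4, h5, Pi.smul_apply, Pi.smul_apply, h1, h2, smul_eq_mul, smul_eq_mul]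
      ring
    · simp only [Prod.snd_add, Prod.smul_snd, smul_eq_mul]
      rw [hcombI P1 f f' a b hf hf' hfM hfM', hcombI P2 g g' a b hg hg' hgM hgM',
        hcombI N g g' a b hg hg' hgM hgM']
      have hk : K = a * K + b * K := by rw [← add_mul, hab, one_mul]
      have h1 := mul_le_mul_of_nonneg_left hx2 ha
      have h2 := mul_le_mul_of_nonneg_left hy2 hb
      linarith
  have hz : LipschitzWith 1 (fun _ : Z => (0 : ℝ)) := LipschitzWith.const' 0
  have hne : C.Nonempty := by
    refine ⟨(0, -K), fun _ => 0, fun _ => 0, hz, hz, ⟨0, by simp⟩, ⟨0, by simp⟩, ?_, by simp⟩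
    filter_upwards [Lp.coeFn_zero ℝ 2 N] with z h
    change ((0 : Lp ℝ 2 N) : Z → ℝ) z = _
    rw [h]
    simp
  obtain ⟨l, hl1, hl2⟩ := sandwich q hqc (by
      intro x y
      simp only [q]
      rw [← integral_add (hpint x) (hpint y)]
      refine integral_mono_ae (hpint _) ((hpint x).add (hpint y)) ?_
      filter_upwards [Lp.coeFn_add x y] with z h
      simp only [h, Pi.add_apply]
      exact max_le (add_le_add (le_max_left _ _) (le_max_left _ _))
        (add_nonneg (le_max_right _ _) (le_max_right _ _)))
    (by
      intro r x hr
      simp only [q]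
      rw [← integral_const_mul]
      refine integral_congr_ae ?_
      filter_upwards [Lp.coeFn_smul r x] with z h
      rw [h, Pi.smul_apply, smul_eq_mul, mul_max_of_nonneg _ _ hr, mul_zero]) C hC hne (by
      rintro b ⟨f, g, hf, hg, hfM, hgM, hb1, hb2⟩
      refine hb2.trans ?_
      have e1 : q b.1 = ∫ z, max (f z - g z) 0 ∂N := by
        refine integral_congr_ae ?_
        filter_upwards [hb1] with z h
        rw [h]
      have hm : LipschitzWith 1 (fun z => max (f z) (g z)) := by simpa using hf.max hg
      have hmM : ∃ M, ∀ z, |max (f z) (g z)| ≤ M := by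
        obtain ⟨M, hM⟩ := hfM
        obtain ⟨M', hM'⟩ := hgM
        refine ⟨max M M', fun z => abs_max_le_max_abs_abs.trans (max_le_max (hM z) (hM' z))⟩
      have e2 : ∫ z, max (f z - g z) 0 ∂N = ∫ z, max (f z) (g z) ∂N - ∫ z, g z ∂N := by
        rw [← integral_sub (hI N _ hm hmM) (hI N _ hg hgM)]
        congr 1; funext z
        rw [← max_sub_sub_right, sub_self]
      have h1 := hK _ hm hmM
      have h2 : ∫ z, f z ∂P1 ≤ ∫ z, max (f z) (g z) ∂P1 :=
        integral_mono (hI P1 _ hf hfM) (hI P1 _ hm hmM) (fun z => le_max_left _ _)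
      have h3 : ∫ z, g z ∂P2 ≤ ∫ z, max (f z) (g z) ∂P2 :=
        integral_mono (hI P2 _ hg hgM) (hI P2 _ hm hmM) (fun z => le_max_right _ _)
      rw [e1, e2]
      linarith)
  let h : Lp ℝ 2 N := (InnerProductSpace.toDual ℝ (Lp ℝ 2 N)).symm l
  have hh : ∀ v, l v = inner ℝ h v := by
    intro v
    exact (InnerProductSpace.toDual_symm_apply).symm
  have hset : ∀ s (hs : MeasurableSet s), l (indicatorConstLp 2 hs (measure_ne_top N s) (1 : ℝ))
      = ∫ z in s, h z ∂N := by
    intro s hs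
    rw [hh, real_inner_comm, L2.inner_indicatorConstLp_one]
  refine ⟨h, ?_, ?_, ?_⟩
  · refine ae_nonneg_of_forall_setIntegral_nonneg (hvint h) fun s hs _ => ?_
    have h1 := hl1 (-(indicatorConstLp 2 hs (measure_ne_top N s) (1 : ℝ)))
    rw [map_neg, hset] at h1
    have h2 : q (-(indicatorConstLp 2 hs (measure_ne_top N s) (1 : ℝ))) = 0 := by
      simp only [q]
      rw [integral_eq_zero_of_ae]
      filter_upwards [Lp.coeFn_neg (indicatorConstLp 2 hs (measure_ne_top N s) (1 : ℝ)),
        indicatorConstLp_coeFn (p := 2) (hs := hs) (hμs := measure_ne_top N s) (c := (1 : ℝ))]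
        with z h1 h2
      rw [h1, Pi.neg_apply, h2]
      by_cases hz : z ∈ s <;> simp [hz]
    linarith
  · refine ae_le_of_forall_setIntegral_le (hvint h) (integrable_const _) fun s hs _ => ?_
    have h1 := hl1 (indicatorConstLp 2 hs (measure_ne_top N s) (1 : ℝ))
    rw [hset] at h1
    refine h1.trans (le_of_eq ?_)
    simp only [q]
    rw [← integral_indicator hs]
    refine integral_congr_ae ?_
    filter_upwards [
        indicatorConstLp_coeFn (p := 2) (hs := hs) (hμs := measure_ne_top N s) (c := (1 : ℝ))]
        with z h2
    rw [h2]
    by_cases hz : z ∈ s <;> simp [hz]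
  · intro f g hf hg hfM hgM
    have hmem : MemLp (fun z => f z - g z) 2 N := by
      obtain ⟨M, hM⟩ := hfM
      obtain ⟨M', hM'⟩ := hgM
      refine MemLp.of_bound (hf.continuous.sub hg.continuous).aestronglyMeasurable (M + M')
        (ae_of_all _ fun z => ?_)
      exact (norm_sub_le _ _).trans (add_le_add (hM z) (hM' z))
    have h1 := hl2 (hmem.toLp, ∫ z, f z ∂P1 + ∫ z, g z ∂P2 - ∫ z, g z ∂N - K)
      ⟨f, g, hf, hg, hfM, hgM, hmem.coeFn_toLp, le_rfl⟩
    refine h1.trans (le_of_eq ?_)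
    rw [hh, L2.inner_def]
    refine integral_congr_ae ?_
    filter_upwards [hmem.coeFn_toLp] with z hz
    simp only [hz]
    simp [mul_comm]

lemma lip_integrable [SecondCountableTopology Z] {Q : Measure Z} [IsFiniteMeasure Q] (e : Z)
    (hQ : Integrable (fun z => dist z e) Q) {f : Z → ℝ} (hf : LipschitzWith 1 f) :
    Integrable f Q := by
  refine Integrable.mono' ((integrable_const |f e|).add hQ) hf.continuous.aestronglyMeasurable
    (ae_of_all _ fun z => ?_)
  have h1 := hf.dist_le_mul z e
  simp only [NNReal.coe_one, one_mul, Real.dist_eq] at h1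
  simp only [Pi.add_apply, Real.norm_eq_abs]
  have := abs_sub_abs_le_abs_sub (f z) (f e)
  linarith

/-- truncation -/
def trunc (f : Z → ℝ) (n : ℕ) (z : Z) : ℝ := max (-(n : ℝ)) (min (n : ℝ) (f z))

lemma trunc_lip {f : Z → ℝ} (hf : LipschitzWith 1 f) (n : ℕ) : LipschitzWith 1 (trunc f n) :=
  (hf.const_min (n : ℝ)).const_max (-(n : ℝ))

lemma trunc_bdd (f : Z → ℝ) (n : ℕ) : ∃ M, ∀ z, |trunc f n z| ≤ M := by
  refine ⟨n, fun z => ?_⟩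
  have hn : (0 : ℝ) ≤ n := n.cast_nonneg
  rw [abs_le]
  exact ⟨le_max_left _ _, max_le (by linarith) (min_le_left _ _)⟩

lemma trunc_le (f : Z → ℝ) (n : ℕ) (z : Z) : |trunc f n z| ≤ |f z| := by
  have hn : (0 : ℝ) ≤ n := n.cast_nonneg
  rw [abs_le]
  unfold trunc
  constructor
  · refine le_max_of_le_right (le_min ?_ (neg_abs_le _))
    linarith [abs_nonneg (f z)]
  · refine max_le ?_ ((min_le_right _ _).trans (le_abs_self _))
    linarith [abs_nonneg (f z)]

lemma trunc_eq (f : Z → ℝ) (n : ℕ) (z : Z) (h : |f z| ≤ n) : trunc f n z = f z := by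
  rw [abs_le] at h
  unfold trunc
  rw [min_eq_right h.2, max_eq_right h.1]

lemma trunc_tendsto [SecondCountableTopology Z] {Q : Measure Z} [IsFiniteMeasure Q] (e : Z)
    (hQ : Integrable (fun z => dist z e) Q) {f : Z → ℝ} (hf : LipschitzWith 1 f) :
    Tendsto (fun n => ∫ z, trunc f n z ∂Q) atTop (𝓝 (∫ z, f z ∂Q)) := by
  refine tendsto_integral_of_dominated_convergence (fun z => |f z|)
    (fun n => (trunc_lip hf n).continuous.aestronglyMeasurable)
    (lip_integrable e hQ hf).abs (fun n => ae_of_all _ fun z => trunc_le f n z)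
    (ae_of_all _ fun z => ?_)
  obtain ⟨m, hm⟩ := exists_nat_ge |f z|
  refine tendsto_atTop_of_eventually_const (i₀ := m) fun n hn => ?_
  exact trunc_eq f n z (hm.trans (by exact_mod_cast hn))

lemma split [SecondCountableTopology Z] (e : Z) (P1 P2 N : Measure Z) [IsFiniteMeasure P1]
    [IsFiniteMeasure P2] [IsFiniteMeasure N] (K : ℝ)
    (hP1 : Integrable (fun z => dist z e) P1) (hP2 : Integrable (fun z => dist z e) P2)
    (hN : Integrable (fun z => dist z e) N)
    (hK : ∀ k : Z → ℝ, LipschitzWith 1 k →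
      ∫ z, k z ∂P1 + ∫ z, k z ∂P2 - ∫ z, k z ∂N ≤ K) :
    ∃ N1 N2 : Measure Z, N1 + N2 = N ∧ N1 Set.univ = P1 Set.univ ∧
      ∀ f g : Z → ℝ, LipschitzWith 1 f → LipschitzWith 1 g →
        (∫ z, f z ∂P1 - ∫ z, f z ∂N1) + (∫ z, g z ∂P2 - ∫ z, g z ∂N2) ≤ K := by
  obtain ⟨h, h0, h1, hh⟩ := split_L2 P1 P2 N K (fun k hk _ => hK k hk)
  have hm : Measurable h := (Lp.stronglyMeasurable h).measurable
  have hm1 : Measurable (fun z => ENNReal.ofReal (h z)) := hm.ennreal_ofReal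
  have hm2 : Measurable (fun z => ENNReal.ofReal (1 - h z)) := (hm.const_sub 1).ennreal_ofReal
  set N1 := N.withDensity (fun z => ENNReal.ofReal (h z)) with hN1
  set N2 := N.withDensity (fun z => ENNReal.ofReal (1 - h z)) with hN2
  have hsum : N1 + N2 = N := by
    rw [hN1, hN2, ← withDensity_add_left hm1]
    conv_rhs => rw [← withDensity_one (μ := N)]
    refine withDensity_congr_ae ?_
    filter_upwards [h0, h1] with z h0 h1
    simp only [Pi.zero_apply] at h0
    simp only [Pi.add_apply, Pi.one_apply]
    rw [← ENNReal.ofReal_add h0 (by linarith)]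
    simp
  have hle1 : N1 ≤ N := by rw [← hsum]; exact Measure.le_add_right le_rfl
  have hle2 : N2 ≤ N := by rw [← hsum]; exact Measure.le_add_left le_rfl
  haveI : IsFiniteMeasure N1 := isFiniteMeasure_of_le N hle1
  haveI : IsFiniteMeasure N2 := isFiniteMeasure_of_le N hle2
  have hi1 : ∀ f : Z → ℝ, ∫ z, f z ∂N1 = ∫ z, h z * f z ∂N := by
    intro f
    rw [hN1, integral_withDensity_eq_integral_toReal_smul hm1 (ae_of_all _ (by simp))]
    refine integral_congr_ae ?_
    filter_upwards [h0] with z h0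
    rw [ENNReal.toReal_ofReal h0, smul_eq_mul]
  have hb : ∀ f g : Z → ℝ, LipschitzWith 1 f → LipschitzWith 1 g →
      (∃ M, ∀ z, |f z| ≤ M) → (∃ M, ∀ z, |g z| ≤ M) →
        (∫ z, f z ∂P1 - ∫ z, f z ∂N1) + (∫ z, g z ∂P2 - ∫ z, g z ∂N2) ≤ K := by
    rintro f g hf hg ⟨M, hM⟩ ⟨M', hM'⟩
    have key := hh f g hf hg ⟨M, hM⟩ ⟨M', hM'⟩
    rw [← hi1 (fun z => f z - g z), integral_sub (lip_bdd_integrable hf.continuous hM)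
      (lip_bdd_integrable hg.continuous hM')] at key
    have e1 : ∫ z, g z ∂N = ∫ z, g z ∂N1 + ∫ z, g z ∂N2 := by
      conv_lhs => rw [← hsum]
      exact integral_add_measure (lip_bdd_integrable hg.continuous hM')
        (lip_bdd_integrable hg.continuous hM')
    linarith
  refine ⟨N1, N2, hsum, ?_, ?_⟩
  · have hz : ∀ C : ℝ, LipschitzWith 1 (fun _ : Z => C) := fun C => LipschitzWith.const' C
    have hc : ∀ C : ℝ, C * (P1.real Set.univ - N1.real Set.univ) ≤ K := by
      intro C
      have := hb (fun _ => C) (fun _ => 0) (hz C) (hz 0) ⟨|C|, by simp⟩ ⟨0, by simp⟩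
      simp only [integral_const, smul_eq_mul, mul_zero, sub_self, add_zero] at this
      linarith
    have : P1.real Set.univ - N1.real Set.univ = 0 := by
      by_contra hne
      have := hc ((K + 1) / (P1.real Set.univ - N1.real Set.univ))
      rw [div_mul_cancel₀ _ hne] at this
      linarith
    have h3 : N1.real Set.univ = P1.real Set.univ := by linarith
    rwa [measureReal_def, measureReal_def,
      ENNReal.toReal_eq_toReal_iff' (measure_ne_top _ _) (measure_ne_top _ _)] at h3
  · intro f g hf hg
    have hd1 := hN.mono_measure hle1
    have hd2 := hN.mono_measure hle2
    refine le_of_tendsto' (((trunc_tendsto e hP1 hf).sub (trunc_tendsto e hd1 hf)).add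
      ((trunc_tendsto e hP2 hg).sub (trunc_tendsto e hd2 hg))) fun n => ?_
    exact hb _ _ (trunc_lip hf n) (trunc_lip hg n) (trunc_bdd f n) (trunc_bdd g n)

/-- A zero-one finite measure is a multiple of a Dirac mass. -/
lemma zero_one_dirac [SecondCountableTopology Z] (P : Measure Z) [IsFiniteMeasure P]
    (hP : P ≠ 0) (h : ∀ B, MeasurableSet B → P B = 0 ∨ P Bᶜ = 0) :
    ∃ x, P = P Set.univ • Measure.dirac x := by
  obtain ⟨x, hx⟩ := Measure.nonempty_support hP
  rw [Measure.mem_support_iff_forall] at hx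
  have hb : ∀ n : ℕ, P (Metric.ball x (1 / ((n : ℝ) + 1)))ᶜ = 0 := by
    intro n
    have := hx _ (Metric.ball_mem_nhds x (show (0 : ℝ) < 1 / ((n : ℝ) + 1) by positivity))
    exact (h _ Metric.isOpen_ball.measurableSet).resolve_left this.ne'
  have hc : P {x}ᶜ = 0 := by
    refine measure_mono_null ?_ (measure_iUnion_null hb)
    intro y hy
    have hd : 0 < dist y x := dist_pos.2 hy
    obtain ⟨n, hn⟩ := exists_nat_one_div_lt hd
    exact Set.mem_iUnion.2 ⟨n, by simpa [Metric.mem_ball] using hn.le⟩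
  refine ⟨x, ?_⟩
  have hr : P.restrict {x} = P := by
    rw [Measure.restrict_eq_self_of_ae_mem]
    rw [ae_iff]
    exact hc
  have hx1 : P {x} = P Set.univ := by
    conv_rhs => rw [← hr]
    simp
  rw [← hx1, ← Measure.restrict_singleton, hr]

lemma jordan_apply (j : JordanDecomposition Z) {i : Set Z} (hi : MeasurableSet i) :
    j.toSignedMeasure i = j.posPart.real i - j.negPart.real i := by
  rw [JordanDecomposition.toSignedMeasure, Measure.toSignedMeasure_sub_apply hi]

lemma tv_add_dirac (j : JordanDecomposition Z) (e : Z) (c : ℝ) :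
    (j.toSignedMeasure + c • diracSM e).totalVariation =
      (j.posPart + j.negPart).restrict {e}ᶜ +
        ENNReal.ofReal |j.toSignedMeasure {e} + c| • Measure.dirac e := by
  set a := j.toSignedMeasure {e} + c with ha
  have hme : MeasurableSet ({e}ᶜ : Set Z) := (measurableSet_singleton e).compl
  have hrd : ∀ (Q : Measure Z) (r : ℝ≥0), Q.restrict {e}ᶜ ⟂ₘ (r • Measure.dirac e) := by
    intro Q r
    refine ⟨{e}, measurableSet_singleton e, ?_, ?_⟩
    · rw [Measure.restrict_apply (measurableSet_singleton e)]; simp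
    · simp [Measure.dirac_apply' e hme]
  have hdd : ((a.toNNReal • Measure.dirac e : Measure Z)) ⟂ₘ
      ((-a).toNNReal • Measure.dirac e : Measure Z) := by
    rcases le_total 0 a with h | h
    · rw [Real.toNNReal_of_nonpos (by linarith : -a ≤ 0), zero_smul]
      exact Measure.MutuallySingular.zero_right
    · rw [Real.toNNReal_of_nonpos h, zero_smul]
      exact Measure.MutuallySingular.zero_left
  let J : JordanDecomposition Z :=
    { posPart := j.posPart.restrict {e}ᶜ + a.toNNReal • Measure.dirac e
      negPart := j.negPart.restrict {e}ᶜ + (-a).toNNReal • Measure.dirac e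
      mutuallySingular := by
        rw [Measure.MutuallySingular.add_left_iff, Measure.MutuallySingular.add_right_iff,
          Measure.MutuallySingular.add_right_iff]
        refine ⟨⟨?_, hrd _ _⟩, (hrd _ _).symm, hdd⟩
        exact j.mutuallySingular.mono Measure.restrict_le_self Measure.restrict_le_self }
  have hJ : j.toSignedMeasure + c • diracSM e = J.toSignedMeasure := by
    ext i hi
    rw [jordan_apply J hi]
    have h1 : (j.toSignedMeasure + c • diracSM e) i
        = j.toSignedMeasure i + c * (Measure.dirac e).real i := by
      simp [diracSM, Measure.toSignedMeasure_apply, hi]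
    have hreal : ∀ (Q : Measure Z) [IsFiniteMeasure Q] (r : ℝ≥0),
        (Q.restrict {e}ᶜ + r • Measure.dirac e).real i
          = Q.real (i ∩ {e}ᶜ) + r * (Measure.dirac e).real i := by
      intro Q _ r
      rw [measureReal_add_apply, measureReal_restrict_apply hi, measureReal_nnreal_smul_apply]
    have hspl : ∀ (Q : Measure Z) [IsFiniteMeasure Q],
        Q.real i = Q.real (i ∩ {e}ᶜ) + Q.real {e} * (Measure.dirac e).real i := by
      intro Q _
      by_cases he : e ∈ i
      · have e1 : (Measure.dirac e).real i = 1 := by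
          simp [measureReal_def, Measure.dirac_apply' e hi, he]
        have e2 := measureReal_inter_add_sdiff (μ := Q) (s := i) (measurableSet_singleton e)
        rw [Set.inter_eq_right.2 (Set.singleton_subset_iff.2 he), Set.sdiff_eq] at e2
        rw [e1]; linarith
      · have e1 : (Measure.dirac e).real i = 0 := by
          simp [measureReal_def, Measure.dirac_apply' e hi, he]
        have : i ∩ {e}ᶜ = i := by
          rw [Set.inter_eq_left]; intro y hy hye; exact he (hye ▸ hy)
        rw [e1, this]; simp
    have ha2 : (a.toNNReal : ℝ) - ((-a).toNNReal : ℝ) = a := by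
      rw [Real.coe_toNNReal', Real.coe_toNNReal']
      rcases le_total 0 a with h | h
      · rw [max_eq_left h, max_eq_right (by linarith)]; ring
      · rw [max_eq_right h, max_eq_left (by linarith)]; ring
    rw [h1, hreal, hreal, jordan_apply j hi, hspl j.posPart, hspl j.negPart]
    rw [jordan_apply j (measurableSet_singleton e)] at ha
    linear_combination (- (Measure.dirac e).real i) * ha2 - (Measure.dirac e).real i * ha
  rw [SignedMeasure.totalVariation, hJ, SignedMeasure.toJordanDecomposition_eq rfl]
  have h3 : ENNReal.ofReal |a| = (a.toNNReal : ℝ≥0∞) + ((-a).toNNReal : ℝ≥0∞) := by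
    rcases le_total 0 a with h | h
    · rw [abs_of_nonneg h, Real.toNNReal_of_nonpos (by linarith : -a ≤ 0)]; simp [ENNReal.ofReal]
    · rw [abs_of_nonpos h, Real.toNNReal_of_nonpos h]; simp [ENNReal.ofReal]
  rw [h3, add_smul, Measure.restrict_add]
  change (j.posPart.restrict {e}ᶜ + a.toNNReal • Measure.dirac e) +
    (j.negPart.restrict {e}ᶜ + (-a).toNNReal • Measure.dirac e) = _
  rw [add_add_add_comm]
  rfl

lemma measurable_w (e : Z) (p : ℝ) : Measurable (fun z : Z => ENNReal.ofReal (1 + dist z e ^ p)) := by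
  fun_prop

lemma momLint_formula (j : JordanDecomposition Z) (e : Z) (p : ℝ) (hp : 1 ≤ p) (c : ℝ) :
    momLint e p (j.toSignedMeasure + c • diracSM e) =
      (∫⁻ z in {e}ᶜ, ENNReal.ofReal (1 + dist z e ^ p) ∂(j.posPart + j.negPart)) +
        ENNReal.ofReal |j.toSignedMeasure {e} + c| := by
  unfold momLint
  rw [tv_add_dirac, lintegral_add_measure, lintegral_smul_measure,
    lintegral_dirac' e (measurable_w e p)]
  have : (0 : ℝ) ^ p = 0 := Real.zero_rpow (by linarith)
  simp [this]

lemma sInteg_smul (ν : SignedMeasure Z) (r : ℝ) (hr : 0 ≤ r) (f : Z → ℝ) :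
    sInteg (r • ν) f = r * sInteg ν f := by
  unfold sInteg
  rw [SignedMeasure.toJordanDecomposition_smul_real,
    JordanDecomposition.real_smul_posPart_nonneg _ _ hr,
    JordanDecomposition.real_smul_negPart_nonneg _ _ hr, integral_smul_nnreal_measure,
    integral_smul_nnreal_measure]
  simp only [NNReal.smul_def, Real.coe_toNNReal r hr, smul_eq_mul]
  ring

lemma krNorm_smul (e : Z) (ν : SignedMeasure Z) (r : ℝ) (hr : 0 ≤ r) :
    krNorm e (r • ν) = r * krNorm e ν := by
  unfold krNorm
  rw [← smul_eq_mul, ← Real.sSup_smul_of_nonneg hr]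
  congr 1
  ext x
  rw [Set.mem_smul_set]
  constructor
  · rintro ⟨f, h1, h2, h3⟩
    exact ⟨sInteg ν f, ⟨f, h1, h2, rfl⟩, by rw [h3, sInteg_smul _ _ hr]; rfl⟩
  · rintro ⟨y, ⟨f, h1, h2, h3⟩, h4⟩
    exact ⟨f, h1, h2, by rw [sInteg_smul _ _ hr, ← h4, h3]; rfl⟩

lemma tv_smul (ν : SignedMeasure Z) (r : ℝ) (hr : 0 ≤ r) :
    (r • ν).totalVariation = ENNReal.ofReal r • ν.totalVariation := by
  unfold SignedMeasure.totalVariation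
  rw [SignedMeasure.toJordanDecomposition_smul_real,
    JordanDecomposition.real_smul_posPart_nonneg _ _ hr,
    JordanDecomposition.real_smul_negPart_nonneg _ _ hr, ← smul_add]
  rfl

lemma momLint_smul (e : Z) (p : ℝ) (ν : SignedMeasure Z) (r : ℝ) (hr : 0 ≤ r) :
    momLint e p (r • ν) = ENNReal.ofReal r * momLint e p ν := by
  unfold momLint
  rw [tv_smul _ _ hr, lintegral_smul_measure, smul_eq_mul]

lemma MemMp_smul (e : Z) (p : ℝ) (ν : SignedMeasure Z) (r : ℝ) (hr : 0 ≤ r) (h : MemMp e p ν) :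
    MemMp e p (r • ν) := by
  unfold MemMp at *
  rw [tv_smul _ _ hr, lintegral_smul_measure, smul_eq_mul]
  exact ENNReal.mul_lt_top ENNReal.ofReal_lt_top h

lemma Gaux_smul (e : Z) (p α β : ℝ) (x : SignedMeasure Z × ℝ) (r : ℝ) (hr : 0 ≤ r) :
    Gaux e p α β (r • x) = ENNReal.ofReal r * Gaux e p α β x := by
  unfold Gaux
  have h1 : (r • x).1 + (r • x).2 • diracSM e = r • (x.1 + x.2 • diracSM e) := by
    rw [smul_add, smul_smul]; rfl
  rw [h1, momLint_smul _ _ _ _ hr, Prod.smul_fst, Prod.smul_snd, krNorm_smul _ _ _ hr,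
    smul_eq_mul, abs_mul, abs_of_nonneg hr, mul_add, mul_add, ← ENNReal.ofReal_mul hr,
    ← ENNReal.ofReal_mul hr]
  congr 1
  · congr 2 <;> ring
  · ring

lemma Gaux_zero (e : Z) (p α β : ℝ) (hα : 0 < α) (hβ : 0 < β) (x : SignedMeasure Z × ℝ)
    (h : Gaux e p α β x = 0) : x.1 = 0 := by
  unfold Gaux at h
  rw [add_eq_zero, add_eq_zero] at h
  obtain ⟨⟨-, h2⟩, h3⟩ := h
  have hc : x.2 = 0 := by
    rw [ENNReal.ofReal_eq_zero] at h2
    have : |x.2| ≤ 0 := by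
      by_contra hh
      push Not at hh
      nlinarith
    exact abs_nonpos_iff.1 this
  rw [hc, zero_smul, add_zero, mul_eq_zero] at h3
  have h4 : momLint e p x.1 = 0 := h3.resolve_left (by simpa using hβ)
  unfold momLint at h4
  rw [lintegral_eq_zero_iff (measurable_w e p)] at h4
  have h5 : x.1.totalVariation = 0 := by
    rw [← ae_eq_bot, ← Filter.eventually_false_iff_eq_bot]
    filter_upwards [h4] with z hz
    simp only [Pi.zero_apply, ENNReal.ofReal_eq_zero] at hz
    have : (0 : ℝ) ≤ dist z e ^ p := Real.rpow_nonneg dist_nonneg _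
    linarith
  ext i hi
  exact SignedMeasure.null_of_totalVariation_zero _ (by rw [h5]; rfl)

lemma extreme_prop (e : Z) (p α β : ℝ) (hα : 0 < α) (hβ : 0 < β)
    (x x1 x2 : SignedMeasure Z × ℝ)
    (hx : x ∈ Set.extremePoints ℝ {vc : SignedMeasure Z × ℝ |
          vc.1 Set.univ = 0 ∧ MemMp e p vc.1 ∧ Gaux e p α β vc ≤ 1})
    (hsum : x1 + x2 = x) (h1 : x1.1 Set.univ = 0) (h2 : x2.1 Set.univ = 0)
    (hm1 : MemMp e p x1.1) (hm2 : MemMp e p x2.1)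
    (hG : Gaux e p α β x1 + Gaux e p α β x2 ≤ 1) :
    ∃ r : ℝ, 0 ≤ r ∧ x1.1 = r • x.1 := by
  by_cases hz1 : Gaux e p α β x1 = 0
  · exact ⟨0, le_rfl, by rw [Gaux_zero e p α β hα hβ x1 hz1, zero_smul]⟩
  by_cases hz2 : Gaux e p α β x2 = 0
  · refine ⟨1, zero_le_one, ?_⟩
    rw [← hsum, Prod.fst_add, Gaux_zero e p α β hα hβ x2 hz2, add_zero, one_smul]
  have hf1 : Gaux e p α β x1 ≠ ⊤ := (lt_of_le_of_lt (le_self_add.trans hG) ENNReal.one_lt_top).ne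
  have hf2 : Gaux e p α β x2 ≠ ⊤ := (lt_of_le_of_lt (le_add_self.trans hG) ENNReal.one_lt_top).ne
  set a := (Gaux e p α β x1).toReal with ha
  set m := (Gaux e p α β x2).toReal with hm
  have ha0 : 0 < a := ENNReal.toReal_pos hz1 hf1
  have hm0 : 0 < m := ENNReal.toReal_pos hz2 hf2
  have ham : a + m ≤ 1 := by
    rw [ha, hm, ← ENNReal.toReal_add hf1 hf2]
    exact ENNReal.toReal_le_of_le_ofReal zero_le_one (by simpa using hG)
  have hea : Gaux e p α β x1 = ENNReal.ofReal a := (ENNReal.ofReal_toReal hf1).symm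
  have hem : Gaux e p α β x2 = ENNReal.ofReal m := (ENNReal.ofReal_toReal hf2).symm
  have hl0 : 0 < 1 - m := by linarith
  rw [mem_extremePoints] at hx
  have key := (hx.2 ((1 - m)⁻¹ • x1) ⟨?_, ?_, ?_⟩ (m⁻¹ • x2) ⟨?_, ?_, ?_⟩ ?_).1
  · refine ⟨1 - m, hl0.le, ?_⟩
    rw [← key, Prod.smul_fst, smul_smul, mul_inv_cancel₀ hl0.ne', one_smul]
  · simp [h1]
  · exact MemMp_smul e p _ _ (inv_nonneg.2 hl0.le) hm1
  · rw [Gaux_smul _ _ _ _ _ _ (inv_nonneg.2 hl0.le), hea, ← ENNReal.ofReal_mul (inv_nonneg.2 hl0.le)]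
    rw [ENNReal.ofReal_le_one, inv_mul_le_iff₀ hl0]
    linarith
  · simp [h2]
  · exact MemMp_smul e p _ _ (inv_nonneg.2 hm0.le) hm2
  · rw [Gaux_smul _ _ _ _ _ _ (inv_nonneg.2 hm0.le), hem, ← ENNReal.ofReal_mul (inv_nonneg.2 hm0.le),
      inv_mul_cancel₀ hm0.ne']
    simp
  · refine ⟨1 - m, m, hl0, hm0, by ring, ?_⟩
    rw [smul_smul, smul_smul, mul_inv_cancel₀ hl0.ne', mul_inv_cancel₀ hm0.ne', one_smul, one_smul,
      hsum]

lemma dist_integrable [SecondCountableTopology Z] (e : Z) (p : ℝ) (hp : 1 ≤ p) (Q : Measure Z)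
    [IsFiniteMeasure Q]
    (h : (∫⁻ z, ENNReal.ofReal (dist z e ^ p) ∂Q) < ⊤) : Integrable (fun z => dist z e) Q := by
  have hc : Continuous (fun z : Z => dist z e) := by fun_prop
  have hi : Integrable (fun z => dist z e ^ p) Q := by
    refine ⟨(by fun_prop : Measurable (fun z : Z => dist z e ^ p)).aestronglyMeasurable, ?_⟩
    rw [hasFiniteIntegral_iff_ofReal (ae_of_all _ fun z => Real.rpow_nonneg dist_nonneg _)]
    exact h
  refine Integrable.mono' ((integrable_const (1 : ℝ)).add hi) hc.aestronglyMeasurable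
    (ae_of_all _ fun z => ?_)
  simp only [Pi.add_apply, Real.norm_eq_abs, abs_of_nonneg (dist_nonneg (x := z) (y := e))]
  rcases le_total (dist z e) 1 with h | h
  · have : (0 : ℝ) ≤ dist z e ^ p := Real.rpow_nonneg dist_nonneg _
    linarith
  · have := Real.self_le_rpow_of_one_le h hp
    linarith

lemma krNorm_le (e : Z) (j : JordanDecomposition Z) (K : ℝ)
    (h : ∀ f : Z → ℝ, LipschitzWith 1 f → ∫ z, f z ∂j.posPart - ∫ z, f z ∂j.negPart ≤ K) :
    krNorm e j.toSignedMeasure ≤ K := by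
  refine csSup_le ⟨0, fun _ => 0, rfl, LipschitzWith.const' 0, by simp [sInteg]⟩ ?_
  rintro r ⟨f, -, hf, rfl⟩
  unfold sInteg
  rw [SignedMeasure.toJordanDecomposition_eq rfl]
  exact h f hf

lemma krNorm_nonneg (e : Z) (ν : SignedMeasure Z) : 0 ≤ krNorm e ν := by
  refine Real.sSup_nonneg' ⟨0, ⟨fun _ => 0, rfl, LipschitzWith.const' 0, by simp [sInteg]⟩, le_rfl⟩

lemma le_krNorm [SecondCountableTopology Z] (e : Z) (ν : SignedMeasure Z)
    (hb : ν Set.univ = 0)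
    (hP : Integrable (fun z => dist z e) ν.toJordanDecomposition.posPart)
    (hN : Integrable (fun z => dist z e) ν.toJordanDecomposition.negPart)
    (f : Z → ℝ) (hf : LipschitzWith 1 f) :
    ∫ z, f z ∂ν.toJordanDecomposition.posPart - ∫ z, f z ∂ν.toJordanDecomposition.negPart
      ≤ krNorm e ν := by
  set j := ν.toJordanDecomposition with hj
  have hbdd : BddAbove {r : ℝ | ∃ f : Z → ℝ, f e = 0 ∧ LipschitzWith 1 f ∧ r = sInteg ν f} := by
    refine ⟨∫ z, dist z e ∂j.posPart + ∫ z, dist z e ∂j.negPart, ?_⟩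
    rintro r ⟨g, hg0, hg, rfl⟩
    have hle : ∀ z, |g z| ≤ dist z e := by
      intro z
      have := hg.dist_le_mul z e
      simpa [Real.dist_eq, hg0] using this
    unfold sInteg
    rw [← hj]
    have h1 : ∫ z, g z ∂j.posPart ≤ ∫ z, dist z e ∂j.posPart :=
      integral_mono (lip_integrable e hP hg) hP fun z => (le_abs_self _).trans (hle z)
    have h2 : ∫ z, - dist z e ∂j.negPart ≤ ∫ z, g z ∂j.negPart :=
      integral_mono hN.neg (lip_integrable e hN hg) fun z => (abs_le.1 (hle z)).1
    rw [integral_neg] at h2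
    linarith
  have hlip : LipschitzWith 1 (fun z => f z - f e) := by
    refine LipschitzWith.of_dist_le_mul fun x y => ?_
    simpa using hf.dist_le_mul x y
  have h1 := le_csSup hbdd ⟨fun z => f z - f e, sub_self _, hlip, rfl⟩
  refine le_trans (le_of_eq ?_) h1
  unfold sInteg
  rw [← hj, integral_sub (lip_integrable e hP hf) (integrable_const _),
    integral_sub (lip_integrable e hN hf) (integrable_const _)]
  have h2 : j.posPart.real Set.univ = j.negPart.real Set.univ := by
    have := jordan_apply j MeasurableSet.univ
    rw [hj, SignedMeasure.toSignedMeasure_toJordanDecomposition, hb] at this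
    rw [hj]; linarith
  simp only [integral_const, h2]
  ring

lemma main_split [SecondCountableTopology Z] (e : Z) (p α β : ℝ) (hp : 1 ≤ p) (hα : 0 < α)
    (hβ : 0 < β) (x : SignedMeasure Z × ℝ)
    (hx : x ∈ Set.extremePoints ℝ {vc : SignedMeasure Z × ℝ |
          vc.1 Set.univ = 0 ∧ MemMp e p vc.1 ∧ Gaux e p α β vc ≤ 1})
    (P1 P2 N1 N2 : Measure Z)
    (hP : P1 + P2 = x.1.toJordanDecomposition.posPart)
    (hN : N1 + N2 = x.1.toJordanDecomposition.negPart)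
    (hu1 : N1 Set.univ = P1 Set.univ)
    (hkr : ∀ f g : Z → ℝ, LipschitzWith 1 f → LipschitzWith 1 g →
        (∫ z, f z ∂P1 - ∫ z, f z ∂N1) + (∫ z, g z ∂P2 - ∫ z, g z ∂N2) ≤ krNorm e x.1) :
    ∃ r : ℝ≥0, P1 = r • x.1.toJordanDecomposition.posPart ∧
      N1 = r • x.1.toJordanDecomposition.negPart := by
  obtain ⟨hx0, hxm, hxG⟩ := hx.1
  set j := x.1.toJordanDecomposition with hj
  have hjx : j.toSignedMeasure = x.1 := SignedMeasure.toSignedMeasure_toJordanDecomposition _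
  have hP1 : P1 ≤ j.posPart := by rw [← hP]; exact Measure.le_add_right le_rfl
  have hP2 : P2 ≤ j.posPart := by rw [← hP]; exact Measure.le_add_left le_rfl
  have hN1 : N1 ≤ j.negPart := by rw [← hN]; exact Measure.le_add_right le_rfl
  have hN2 : N2 ≤ j.negPart := by rw [← hN]; exact Measure.le_add_left le_rfl
  have iP1 : IsFiniteMeasure P1 := isFiniteMeasure_of_le _ hP1
  have iP2 : IsFiniteMeasure P2 := isFiniteMeasure_of_le _ hP2
  have iN1 : IsFiniteMeasure N1 := isFiniteMeasure_of_le _ hN1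
  have iN2 : IsFiniteMeasure N2 := isFiniteMeasure_of_le _ hN2
  let j1 : JordanDecomposition Z := ⟨P1, N1, j.mutuallySingular.mono hP1 hN1⟩
  let j2 : JordanDecomposition Z := ⟨P2, N2, j.mutuallySingular.mono hP2 hN2⟩
  have hPr : ∀ i, j.posPart.real i = P1.real i + P2.real i := by
    intro i; rw [← hP, measureReal_add_apply]
  have hNr : ∀ i, j.negPart.real i = N1.real i + N2.real i := by
    intro i; rw [← hN, measureReal_add_apply]
  have hj12 : j1.toSignedMeasure + j2.toSignedMeasure = x.1 := by
    rw [← hjx]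
    ext i hi
    have : (j1.toSignedMeasure + j2.toSignedMeasure) i =
      j1.toSignedMeasure i + j2.toSignedMeasure i := rfl
    rw [this, jordan_apply _ hi, jordan_apply _ hi, jordan_apply _ hi, hPr, hNr]
    ring
  have hs1 : j1.toSignedMeasure Set.univ = 0 := by
    rw [jordan_apply _ MeasurableSet.univ]
    simp [j1, measureReal_def, hu1]
  have hs2 : j2.toSignedMeasure Set.univ = 0 := by
    have : j1.toSignedMeasure Set.univ + j2.toSignedMeasure Set.univ = 0 := by
      rw [← hx0, ← hj12]; rfl
    linarith
  have hme := measurableSet_singleton e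
  -- splitting of the atom at e
  obtain ⟨t, ht0, ht1, hte1, hte2⟩ : ∃ t : ℝ, 0 ≤ t ∧ t ≤ 1 ∧
      j1.toSignedMeasure {e} = t * j.toSignedMeasure {e} ∧
      j2.toSignedMeasure {e} = (1 - t) * j.toSignedMeasure {e} := by
    have hsing : j.posPart.real {e} = 0 ∨ j.negPart.real {e} = 0 := by
      obtain ⟨S, -, hS1, hS2⟩ := j.mutuallySingular
      by_cases he : e ∈ S
      · left
        rw [measureReal_def, measure_mono_null (Set.singleton_subset_iff.2 he) hS1]; rfl
      · right
        rw [measureReal_def, measure_mono_null (Set.singleton_subset_iff.2 he) hS2]; rfl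
    rw [jordan_apply _ hme, jordan_apply _ hme, jordan_apply _ hme, hPr, hNr]
    rw [hPr, hNr] at hsing
    change ∃ t : ℝ, 0 ≤ t ∧ t ≤ 1 ∧ P1.real {e} - N1.real {e} = _ ∧ P2.real {e} - N2.real {e} = _
    have a1 : 0 ≤ P1.real {e} := measureReal_nonneg
    have a2 : 0 ≤ P2.real {e} := measureReal_nonneg
    have b1 : 0 ≤ N1.real {e} := measureReal_nonneg
    have b2 : 0 ≤ N2.real {e} := measureReal_nonneg
    generalize P1.real {e} = a at *
    generalize P2.real {e} = b at *
    generalize N1.real {e} = c at *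
    generalize N2.real {e} = d at *
    rcases hsing with h | h
    · have : a = 0 := by linarith
      have : b = 0 := by linarith
      subst a b
      by_cases hcd : c + d = 0
      · exact ⟨0, le_rfl, zero_le_one, by linarith, by linarith⟩
      · refine ⟨c / (c + d), by positivity, div_le_one_of_le₀ (by linarith) (by linarith), ?_, ?_⟩
        · field_simp; ring
        · field_simp; ring
    · have : c = 0 := by linarith
      have : d = 0 := by linarith
      subst c d
      by_cases hcd : a + b = 0
      · exact ⟨0, le_rfl, zero_le_one, by linarith, by linarith⟩
      · refine ⟨a / (a + b), by positivity, div_le_one_of_le₀ (by linarith) (by linarith), ?_, ?_⟩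
        · field_simp; ring
        · field_simp; ring
  have htv : ∀ k : JordanDecomposition Z, k.toSignedMeasure.totalVariation
      = k.posPart + k.negPart := by
    intro k
    rw [SignedMeasure.totalVariation, SignedMeasure.toJordanDecomposition_eq rfl]
  have hmem : ∀ k : JordanDecomposition Z, k.posPart ≤ j.posPart → k.negPart ≤ j.negPart →
      MemMp e p k.toSignedMeasure := by
    intro k h1 h2
    unfold MemMp at *
    refine lt_of_le_of_lt (lintegral_mono' ?_ le_rfl) hxm
    rw [htv k, ← hjx, htv j]
    exact add_le_add h1 h2
  have hkrsum : krNorm e j1.toSignedMeasure + krNorm e j2.toSignedMeasure ≤ krNorm e x.1 := by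
    have h1 : ∀ g : Z → ℝ, LipschitzWith 1 g → krNorm e j1.toSignedMeasure ≤
        krNorm e x.1 - (∫ z, g z ∂P2 - ∫ z, g z ∂N2) := by
      intro g hg
      refine krNorm_le e j1 _ fun f hf => ?_
      have := hkr f g hf hg
      change ∫ z, f z ∂P1 - ∫ z, f z ∂N1 ≤ _
      linarith
    have h2 : krNorm e j2.toSignedMeasure ≤ krNorm e x.1 - krNorm e j1.toSignedMeasure := by
      refine krNorm_le e j2 _ fun g hg => ?_
      have := h1 g hg
      change ∫ z, g z ∂P2 - ∫ z, g z ∂N2 ≤ _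
      linarith
    linarith
  have hmom : momLint e p (j1.toSignedMeasure + (t * x.2) • diracSM e) +
      momLint e p (j2.toSignedMeasure + ((1 - t) * x.2) • diracSM e) =
      momLint e p (x.1 + x.2 • diracSM e) := by
    rw [← hjx, momLint_formula _ _ _ hp, momLint_formula _ _ _ hp, momLint_formula _ _ _ hp,
      add_add_add_comm]
    congr 1
    · rw [← lintegral_add_measure, ← Measure.restrict_add]
      congr 2
      rw [← hP, ← hN, add_add_add_comm]
    · rw [← ENNReal.ofReal_add (abs_nonneg _) (abs_nonneg _), hte1, hte2, ← mul_add, ← mul_add,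
        abs_mul, abs_mul, abs_of_nonneg ht0, abs_of_nonneg (sub_nonneg.2 ht1)]
      congr 1
      ring
  have hcs : ENNReal.ofReal (α * |t * x.2|) + ENNReal.ofReal (α * |(1 - t) * x.2|)
      = ENNReal.ofReal (α * |x.2|) := by
    rw [← ENNReal.ofReal_add (by positivity) (by positivity), abs_mul, abs_mul, abs_of_nonneg ht0,
      abs_of_nonneg (sub_nonneg.2 ht1)]
    congr 1
    ring
  have hks : ENNReal.ofReal (α * krNorm e j1.toSignedMeasure) +
      ENNReal.ofReal (α * krNorm e j2.toSignedMeasure) ≤ ENNReal.ofReal (α * krNorm e x.1) := by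
    rw [← ENNReal.ofReal_add (mul_nonneg hα.le (krNorm_nonneg _ _))
      (mul_nonneg hα.le (krNorm_nonneg _ _)), ← mul_add]
    exact ENNReal.ofReal_le_ofReal (mul_le_mul_of_nonneg_left hkrsum hα.le)
  obtain ⟨r, hr, hr1⟩ := extreme_prop e p α β hα hβ x (j1.toSignedMeasure, t * x.2)
    (j2.toSignedMeasure, (1 - t) * x.2) hx
    (Prod.ext hj12 (by simp only [Prod.snd_add]; ring)) hs1 hs2 (hmem j1 hP1 hN1)
    (hmem j2 hP2 hN2) (by
      refine le_trans ?_ hxG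
      unfold Gaux
      rw [← hmom, ← hcs, mul_add, add_add_add_comm]
      refine add_le_add ?_ le_rfl
      rw [add_add_add_comm]
      exact add_le_add hks le_rfl)
  have hjj : j1 = r.toNNReal • j := by
    apply JordanDecomposition.toSignedMeasure_injective
    rw [JordanDecomposition.toSignedMeasure_smul, hjx]
    refine hr1.trans ?_
    rw [NNReal.smul_def, Real.coe_toNNReal r hr]
  refine ⟨r.toNNReal, ?_, ?_⟩
  · exact congrArg JordanDecomposition.posPart hjj
  · exact congrArg JordanDecomposition.negPart hjj

lemma restrict_prop (P : Measure Z) (B : Set Z) (hB : MeasurableSet B) (r : ℝ≥0)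
    (h : P.restrict B = r • P) : P B = 0 ∨ P Bᶜ = 0 := by
  have h1 : (P.restrict B) Bᶜ = (r • P) Bᶜ := by rw [h]
  rw [Measure.restrict_apply hB.compl, Set.compl_inter_self, measure_empty] at h1
  have h2 : (P.restrict B) B = (r • P) B := by rw [h]
  rw [Measure.restrict_apply hB, Set.inter_self] at h2
  by_cases hr : r = 0
  · left
    rw [h2, hr]; simp
  · right
    simpa [hr, eq_comm] using h1

/-- Every extremal point `(ν,c)` of
`B_aux = {(ν,c) ∈ M_p^0(Z) × ℝ : 𝒢_{α,β}(ν,c) ≤ 1}` is of the form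
`(a δ_x − a δ_y, c)` with `x, y ∈ Z`, `a > 0` and `c ∈ ℝ`. -/
theorem extremePoints_Gaux_ball [LocallyCompactSpace Z] [CompleteSpace Z]
    [TopologicalSpace.SeparableSpace Z] (hgeo : IsGeodesic Z) (e : Z)
    (p α β : ℝ) (hp : 1 ≤ p) (hα : 0 < α) (hβ : 0 < β) :
    ∀ vc ∈ Set.extremePoints ℝ
        {vc : SignedMeasure Z × ℝ |
          vc.1 Set.univ = 0 ∧ MemMp e p vc.1 ∧ Gaux e p α β vc ≤ 1},
      ∃ (a : ℝ) (x y : Z) (c : ℝ), 0 < a ∧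
        vc = (a • diracSM x - a • diracSM y, c) := by
  intro x hx
  have : SecondCountableTopology Z := UniformSpace.secondCountable_of_separable Z
  obtain ⟨hx0, hxm, hxG⟩ := hx.1
  set j := x.1.toJordanDecomposition with hj
  have hjx : j.toSignedMeasure = x.1 := SignedMeasure.toSignedMeasure_toJordanDecomposition _
  have hmass : j.posPart Set.univ = j.negPart Set.univ := by
    have := jordan_apply j MeasurableSet.univ
    rw [hjx, hx0] at this
    have h2 : j.posPart.real Set.univ = j.negPart.real Set.univ := by linarith
    rwa [measureReal_def, measureReal_def,
      ENNReal.toReal_eq_toReal_iff' (measure_ne_top _ _) (measure_ne_top _ _)] at h2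
  by_cases hP0 : j.posPart = 0
  · refine ⟨1, e, e, x.2, one_pos, Prod.ext ?_ rfl⟩
    have hN0 : j.negPart = 0 := by
      rw [← Measure.measure_univ_eq_zero, ← hmass, hP0]; rfl
    have : j = 0 := JordanDecomposition.ext hP0 hN0
    rw [← hjx, this, JordanDecomposition.toSignedMeasure_zero, sub_self]
  have hN0 : j.negPart ≠ 0 := by
    intro h
    apply hP0
    rw [← Measure.measure_univ_eq_zero, hmass, h]; rfl
  have hdP : Integrable (fun z => dist z e) j.posPart := by
    refine dist_integrable e p hp _ (lt_of_le_of_lt (lintegral_mono' ?_ le_rfl) hxm)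
    exact Measure.le_add_right le_rfl
  have hdN : Integrable (fun z => dist z e) j.negPart := by
    refine dist_integrable e p hp _ (lt_of_le_of_lt (lintegral_mono' ?_ le_rfl) hxm)
    exact Measure.le_add_left le_rfl
  have hres : ∀ (Q : Measure Z), Integrable (fun z => dist z e) Q → IsFiniteMeasure Q →
      ∀ B, MeasurableSet B → ∀ k : Z → ℝ, LipschitzWith 1 k →
      ∫ z, k z ∂(Q.restrict B) + ∫ z, k z ∂(Q.restrict Bᶜ) = ∫ z, k z ∂Q := by
    intro Q hQ _ B hB k hk
    exact integral_add_compl hB (lip_integrable e hQ hk)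
  have hneg : ∀ k : Z → ℝ, LipschitzWith 1 k → LipschitzWith 1 (fun z => - k z) :=
    fun k hk => hk.neg
  have hPB : ∀ B, MeasurableSet B → j.posPart B = 0 ∨ j.posPart Bᶜ = 0 := by
    intro B hB
    obtain ⟨N1, N2, h1, h2, h3⟩ := split e (j.posPart.restrict B) (j.posPart.restrict Bᶜ) j.negPart
      (krNorm e x.1) hdP.restrict hdP.restrict hdN (fun k hk => by
        rw [hres _ hdP inferInstance B hB k hk]
        exact le_krNorm e x.1 hx0 hdP hdN k hk)
    obtain ⟨r, hr, -⟩ := main_split e p α β hp hα hβ x hx _ _ N1 N2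
      (Measure.restrict_add_restrict_compl hB) h1 h2 h3
    exact restrict_prop _ B hB r hr
  have hNB : ∀ B, MeasurableSet B → j.negPart B = 0 ∨ j.negPart Bᶜ = 0 := by
    intro B hB
    obtain ⟨N1, N2, h1, h2, h3⟩ := split e (j.negPart.restrict B) (j.negPart.restrict Bᶜ) j.posPart
      (krNorm e x.1) hdN.restrict hdN.restrict hdP (fun k hk => by
        rw [hres _ hdN inferInstance B hB k hk]
        have := le_krNorm e x.1 hx0 hdP hdN _ (hneg k hk)
        rw [integral_neg, integral_neg, ← hj] at this
        linarith)
    obtain ⟨r, -, hr⟩ := main_split e p α β hp hα hβ x hx N1 N2 _ _ h1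
      (Measure.restrict_add_restrict_compl hB) h2.symm (fun f g hf hg => by
        have := h3 _ _ (hneg f hf) (hneg g hg)
        rw [integral_neg, integral_neg, integral_neg, integral_neg] at this
        linarith)
    exact restrict_prop _ B hB r hr
  obtain ⟨y, hy⟩ := zero_one_dirac j.posPart hP0 hPB
  obtain ⟨z, hz⟩ := zero_one_dirac j.negPart hN0 hNB
  refine ⟨j.posPart.real Set.univ, y, z, x.2, ?_, Prod.ext ?_ rfl⟩
  · exact ENNReal.toReal_pos (by simpa using hP0) (measure_ne_top _ _)
  · change x.1 = _
    rw [← hjx]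
    ext i hi
    rw [jordan_apply j hi]
    have e1 : j.posPart.real i = j.posPart.real Set.univ * (Measure.dirac y).real i := by
      conv_lhs => rw [hy]
      simp [measureReal_def]
    have e2 : j.negPart.real i = j.posPart.real Set.univ * (Measure.dirac z).real i := by
      conv_lhs => rw [hz, ← hmass]
      simp [measureReal_def]
    rw [e1, e2]
    have : ∀ w : Z, ((j.posPart.real Set.univ • diracSM w : SignedMeasure Z)) i
        = j.posPart.real Set.univ * (Measure.dirac w).real i := by
      intro w
      simp [diracSM, Measure.toSignedMeasure_apply, hi]
    rw [← this, ← this]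
    rfl
end
end
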